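/- arXiv:1012.2381 — 4 statements merged into one kernel-verified Lean document; each statement's English description precedes it below -/
import Mathlib

section
/- Let Δ be a countably infinite ordered homogeneous Ramsey structure with finite relational signature, let f be any function from the domain of Δ to itself, and let c₁, …, cₙ be elements of Δ. Then f generates over Δ a function g that agrees with f on {c₁, …, cₙ} and is canonical as a function from (Δ, c₁, …, cₙ) to Δ. -/
open FirstOrder FirstOrder.Language

namespace PaperDef

/-- The structure `M` is *ordered*: some binary relation symbol of the signature
denotes a linear order on the domain. -/
def Ordered (L : Language) (M : Type*) [L.Structure M] : Prop :=
  ∃ r : L.Relations 2, IsLinearOrder M (fun a b => Structure.RelMap r ![a, b])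

/-- A class of structures is a *Ramsey class*. -/
def RamseyClass {L : Language} (K : Set (CategoryTheory.Bundled.{0} L.Structure)) : Prop :=
  ∀ k : ℕ, 1 ≤ k → ∀ H ∈ K, ∀ P ∈ K, ∃ S ∈ K,
    ∀ χ : {Q : L.Substructure S // Nonempty (P ≃[L] Q)} → Fin k,
      ∃ e : H ↪[L] S,
        ∀ Q₁ Q₂ : {Q : L.Substructure S // Nonempty (P ≃[L] Q)},
          (Q₁.1 : Set S) ⊆ Set.range e → (Q₂.1 : Set S) ⊆ Set.range e → χ Q₁ = χ Q₂

/-- `M` is *finitely bounded*: membership of a finite(ly generated) structure in the age of `M`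
is characterized by finitely many forbidden substructures. -/
def FinitelyBounded (L : Language) (M : Type) [L.Structure M] : Prop :=
  ∃ (k : ℕ) (F : Fin k → CategoryTheory.Bundled.{0} L.Structure),
    (∀ i, Structure.FG L (F i)) ∧
    ∀ A : CategoryTheory.Bundled.{0} L.Structure, Structure.FG L A →
      (A ∈ L.age M ↔ ∀ i, ¬ Nonempty ((F i) ↪[L] A))

/-- The `L'`-structure on `M` is a *reduct* of the `L`-structure on `M`:
every relation of the former is first-order definable in the latter. -/
def IsReduct (L L' : Language) (M : Type*) [L.Structure M] [L'.Structure M] : Prop :=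
  ∀ (n : ℕ) (r : L'.Relations n), ∃ φ : L.Formula (Fin n),
    ∀ x : Fin n → M, Structure.RelMap r x ↔ φ.Realize x

/-- Two `n`-tuples have the same (complete first-order) type. -/
def SameType (L : Language) (M : Type*) [L.Structure M] {n : ℕ} (a b : Fin n → M) : Prop :=
  ∀ φ : L.Formula (Fin n), φ.Realize a ↔ φ.Realize b

/-- A function is *canonical*: it maps tuples of equal types to tuples of equal types. -/
def Canonical (L L' : Language) (X Ω : Type*) [L.Structure X] [L'.Structure Ω]
    (f : X → Ω) : Prop :=
  ∀ (n : ℕ) (a b : Fin n → X), SameType L X a b →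
    SameType L' Ω (fun i => f (a i)) (fun i => f (b i))

/-- A function is *canonical on a set `F`*. -/
def CanonicalOn (L L' : Language) (X Ω : Type*) [L.Structure X] [L'.Structure Ω]
    (F : Set X) (f : X → Ω) : Prop :=
  ∀ (n : ℕ) (a b : Fin n → X), (∀ i, a i ∈ F) → (∀ i, b i ∈ F) → SameType L X a b →
    SameType L' Ω (fun i => f (a i)) (fun i => f (b i))

/-- `M` is ω-categorical: every countable model of its complete theory is isomorphic to it. -/
def OmegaCategorical (L : Language) (M : Type) [L.Structure M] : Prop :=
  ∀ (N : Type) [L.Structure N], Countable N →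
    (∀ φ : L.Sentence, φ ∈ L.completeTheory M → N ⊨ φ) → Nonempty (M ≃[L] N)

/-- Primitive positive formulas: built from atomic formulas using `∧` and `∃`. -/
inductive IsPrimitivePositive {L : Language} {α : Type*} :
    ∀ {n : ℕ}, L.BoundedFormula α n → Prop
  | atomic {n : ℕ} {φ : L.BoundedFormula α n} (h : φ.IsAtomic) : IsPrimitivePositive φ
  | inf {n : ℕ} {φ ψ : L.BoundedFormula α n} :
      IsPrimitivePositive φ → IsPrimitivePositive ψ → IsPrimitivePositive (φ ⊓ ψ)
  | ex {n : ℕ} {φ : L.BoundedFormula α (n + 1)} :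
      IsPrimitivePositive φ → IsPrimitivePositive φ.ex

/-- Existential formulas: existentially quantified quantifier-free formulas. -/
inductive IsExistential {L : Language} {α : Type*} :
    ∀ {n : ℕ}, L.BoundedFormula α n → Prop
  | of_isQF {n : ℕ} {φ : L.BoundedFormula α n} (h : φ.IsQF) : IsExistential φ
  | ex {n : ℕ} {φ : L.BoundedFormula α (n + 1)} : IsExistential φ → IsExistential φ.ex

/-- Existential positive formulas: built from atomic formulas using `∧`, `∨` and `∃`. -/
inductive IsExistentialPositive {L : Language} {α : Type*} :
    ∀ {n : ℕ}, L.BoundedFormula α n → Prop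
  | atomic {n : ℕ} {φ : L.BoundedFormula α n} (h : φ.IsAtomic) : IsExistentialPositive φ
  | inf {n : ℕ} {φ ψ : L.BoundedFormula α n} :
      IsExistentialPositive φ → IsExistentialPositive ψ → IsExistentialPositive (φ ⊓ ψ)
  | sup {n : ℕ} {φ ψ : L.BoundedFormula α n} :
      IsExistentialPositive φ → IsExistentialPositive ψ → IsExistentialPositive (φ ⊔ ψ)
  | ex {n : ℕ} {φ : L.BoundedFormula α (n + 1)} :
      IsExistentialPositive φ → IsExistentialPositive φ.ex

/-- A `k`-ary operation *preserves* an `m`-ary relation. -/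
def Preserves {D : Type*} {k m : ℕ} (f : (Fin k → D) → D) (R : (Fin m → D) → Prop) : Prop :=
  ∀ rows : Fin k → Fin m → D, (∀ j, R (rows j)) → R (fun i => f (fun j => rows j i))

/-- A unary operation *preserves* an `m`-ary relation. -/
def Preserves1 {D : Type*} {m : ℕ} (f : D → D) (R : (Fin m → D) → Prop) : Prop :=
  ∀ a : Fin m → D, R a → R (fun i => f (a i))

/-- An endomorphism of the structure `M`. -/
def IsEndo (L : Language) (M : Type*) [L.Structure M] (f : M → M) : Prop :=
  ∀ (n : ℕ) (r : L.Relations n) (x : Fin n → M),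
    Structure.RelMap r x → Structure.RelMap r (fun i => f (x i))

/-- A self-embedding of the structure `M`. -/
def IsSelfEmb (L : Language) (M : Type*) [L.Structure M] (f : M → M) : Prop :=
  Function.Injective f ∧ ∀ (n : ℕ) (r : L.Relations n) (x : Fin n → M),
    (Structure.RelMap r (fun i => f (x i)) ↔ Structure.RelMap r x)

/-- A polymorphism of the structure `M`. -/
def IsPoly (L : Language) (M : Type*) [L.Structure M] {k : ℕ} (f : (Fin k → M) → M) : Prop :=
  ∀ (n : ℕ) (r : L.Relations n), Preserves f (fun x : Fin n → M => Structure.RelMap r x)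

/-- The set of endomorphisms of `M`. -/
def EndSet (L : Language) (M : Type*) [L.Structure M] : Set (M → M) :=
  {f | IsEndo L M f}

/-- Two tuples lie in the same orbit of the automorphism group. -/
def SameOrbit (L : Language) (M : Type*) [L.Structure M] {n : ℕ} (a b : Fin n → M) : Prop :=
  ∃ α : M ≃[L] M, ∀ i, α (a i) = b i

/-- The subsets `s` and `t` induce isomorphic substructures. -/
def SetIso (L : Language) (X : Type*) [L.Structure X] (s t : Set X) : Prop :=
  ∃ g : s ≃ t, ∀ (n : ℕ) (r : L.Relations n) (x : Fin n → s),
    (Structure.RelMap r (fun j => ((x j : X))) ↔ Structure.RelMap r (fun j => ((g (x j) : t) : X)))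

/-- The `L[[Fin n]]`-structure on `M` obtained by naming the constants `c 0, …, c (n-1)`. -/
def withConstantsStruct (L : Language) {M : Type*} [L.Structure M] {n : ℕ} (c : Fin n → M) :
    (L[[Fin n]]).Structure M :=
  letI := constantsOn.structure c
  inferInstance

/-- Two sequences of `n` tuples from a product `Ξ₁ × ⋯ × Ξₘ` have the same type:
componentwise, the corresponding `n`-tuples have the same type. -/
def SameSeqType {m : ℕ} (Ls : Fin m → Language) (Xs : Fin m → Type*)
    [∀ i, (Ls i).Structure (Xs i)] {n : ℕ} (a b : Fin n → ∀ i, Xs i) : Prop :=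
  ∀ i, SameType (Ls i) (Xs i) (fun j => a j i) (fun j => b j i)

/-- A function defined on a product of structures is canonical. -/
def CanonicalProd {m : ℕ} (Ls : Fin m → Language) (Xs : Fin m → Type*)
    [∀ i, (Ls i).Structure (Xs i)] (L' : Language) (Ω : Type*) [L'.Structure Ω]
    (f : (∀ i, Xs i) → Ω) : Prop :=
  ∀ (n : ℕ) (a b : Fin n → ∀ i, Xs i), SameSeqType Ls Xs a b →
    SameType L' Ω (fun j => f (a j)) (fun j => f (b j))

end PaperDef


namespace PaperDef

section Monoids

variable {D : Type*}

/-- A closed transformation monoid: contains the identity, is closed under composition,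
and is topologically closed in the topology of pointwise convergence (`D` discrete). -/
def IsClosedTransMonoid (S : Set (D → D)) : Prop :=
  id ∈ S ∧ (∀ g h, g ∈ S → h ∈ S → g ∘ h ∈ S) ∧
    ∀ g : D → D, (∀ F : Set D, F.Finite → ∃ h ∈ S, ∀ x ∈ F, h x = g x) → g ∈ S

/-- The smallest closed transformation monoid containing a given set of unary operations. -/
def ClosedMonoidGenBy (A : Set (D → D)) : Set (D → D) :=
  ⋂₀ {S : Set (D → D) | IsClosedTransMonoid S ∧ A ⊆ S}

/-- `N` is a minimal closed transformation monoid above `M₀`. -/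
def MinimalMonoidAbove (M₀ N : Set (D → D)) : Prop :=
  M₀ ⊂ N ∧ ∀ R : Set (D → D), IsClosedTransMonoid R → M₀ ⊂ R → R ⊆ N → R = N

end Monoids

/-- Terms (compositions) over the generating set consisting of `f` and the automorphisms. -/
inductive MonoidTerm (L : Language) (M : Type*) [L.Structure M] (f : M → M) : (M → M) → Prop
  | id : MonoidTerm L M f id
  | base : MonoidTerm L M f f
  | auto (α : M ≃[L] M) : MonoidTerm L M f α
  | comp {g h : M → M} : MonoidTerm L M f g → MonoidTerm L M f h → MonoidTerm L M f (g ∘ h)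

/-- `f` generates `g` over the structure `M`: `g` lies in the smallest closed transformation
monoid containing `f` and all automorphisms of `M`; equivalently, on every finite set `g`
agrees with some composition of `f` and automorphisms. -/
def GeneratesOverMonoid (L : Language) (M : Type*) [L.Structure M] (f g : M → M) : Prop :=
  ∀ F : Set M, F.Finite → ∃ h : M → M, MonoidTerm L M f h ∧ ∀ x ∈ F, h x = g x

section Clones

variable {D : Type*}

/-- A closed clone: a family of sets of finitary operations containing all projections,
closed under composition, and with every arity-part topologically closed in the topology of
pointwise convergence (`D` discrete). -/
def IsClosedClone (C : ∀ k : ℕ, Set ((Fin k → D) → D)) : Prop :=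
  (∀ (k : ℕ) (i : Fin k), (fun x => x i) ∈ C k) ∧
  (∀ (k l : ℕ) (f : (Fin l → D) → D) (gs : Fin l → (Fin k → D) → D),
      f ∈ C l → (∀ j, gs j ∈ C k) → (fun x => f (fun j => gs j x)) ∈ C k) ∧
  (∀ (k : ℕ) (g : (Fin k → D) → D),
      (∀ F : Set (Fin k → D), F.Finite → ∃ h ∈ C k, ∀ x ∈ F, h x = g x) → g ∈ C k)

/-- Containment of clones. -/
def CloneLE (C C' : ∀ k : ℕ, Set ((Fin k → D) → D)) : Prop :=
  ∀ k, C k ⊆ C' k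

/-- Proper containment of clones. -/
def CloneLT (C C' : ∀ k : ℕ, Set ((Fin k → D) → D)) : Prop :=
  CloneLE C C' ∧ C ≠ C'

/-- `N` is a minimal closed clone above `C₀`. -/
def MinimalCloneAbove (C₀ N : ∀ k : ℕ, Set ((Fin k → D) → D)) : Prop :=
  CloneLT C₀ N ∧ ∀ E : ∀ k : ℕ, Set ((Fin k → D) → D),
    IsClosedClone E → CloneLT C₀ E → CloneLE E N → E = N

/-- The smallest closed clone containing a set `S` of unary operations. -/
def CloneGenByUnary (S : Set (D → D)) : ∀ k : ℕ, Set ((Fin k → D) → D) :=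
  fun k => {g | ∀ C : ∀ j : ℕ, Set ((Fin j → D) → D), IsClosedClone C →
    (∀ e ∈ S, (fun x : Fin 1 → D => e (x 0)) ∈ C 1) → g ∈ C k}

/-- The smallest closed clone containing a set `S` of unary operations together with a
single operation `f` of arity `p`. -/
def CloneGenByUnaryAnd (S : Set (D → D)) {p : ℕ} (f : (Fin p → D) → D) :
    ∀ k : ℕ, Set ((Fin k → D) → D) :=
  fun k => {g | ∀ C : ∀ j : ℕ, Set ((Fin j → D) → D), IsClosedClone C →
    (∀ e ∈ S, (fun x : Fin 1 → D => e (x 0)) ∈ C 1) → f ∈ C p → g ∈ C k}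

end Clones

/-- The polymorphism clone of the structure `M`. -/
def PolSet (L : Language) (M : Type*) [L.Structure M] : ∀ k : ℕ, Set ((Fin k → M) → M) :=
  fun _ => {f | IsPoly L M f}

/-- Clone terms over the generating set consisting of `f` and the automorphisms of `M`. -/
inductive CloneTerm (L : Language) (M : Type*) [L.Structure M] {m : ℕ}
    (f : (Fin m → M) → M) : ∀ {k : ℕ}, ((Fin k → M) → M) → Prop
  | proj {k : ℕ} (i : Fin k) : CloneTerm L M f (fun x => x i)
  | autoComp {k : ℕ} (α : M ≃[L] M) {g : (Fin k → M) → M} :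
      CloneTerm L M f g → CloneTerm L M f (fun x => α (g x))
  | baseComp {k : ℕ} (gs : Fin m → (Fin k → M) → M) :
      (∀ j, CloneTerm L M f (gs j)) → CloneTerm L M f (fun x => f (fun j => gs j x))

/-- `f` generates the `k`-ary operation `g` over the structure `M`: `g` lies in the smallest
closed clone containing `f` and all automorphisms of `M`; equivalently, on every finite set
`g` agrees with some term over `f`, the automorphisms and projections. -/
def GeneratesOverClone (L : Language) (M : Type*) [L.Structure M] {m k : ℕ}
    (f : (Fin m → M) → M) (g : (Fin k → M) → M) : Prop :=
  ∀ F : Set (Fin k → M), F.Finite → ∃ h : (Fin k → M) → M,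
    CloneTerm L M f h ∧ ∀ x ∈ F, h x = g x

end PaperDef

namespace PaperDef

section Helpers

variable {L : Language}

/-- Quantifier-free types of tuples indexed by `ι`. -/
abbrev QT (L : Language) (ι : Type) : Type _ :=
  (ι → ι → Prop) × (∀ r : (Σ i, L.Relations i), (Fin r.1 → ι) → Prop)

/-- The quantifier-free type of a tuple. -/
def qtype {N : Type} [L.Structure N] {ι : Type} (a : ι → N) : QT L ι :=
  (fun i j => a i = a j, fun r s => Structure.RelMap r.2 (fun l => a (s l)))

lemma qtype_eq_iff {N N' : Type} [L.Structure N] [L.Structure N'] {ι : Type}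
    {a : ι → N} {b : ι → N'} :
    qtype (L := L) a = qtype (L := L) b ↔ (∀ i j, a i = a j ↔ b i = b j) ∧
      ∀ (k : ℕ) (r : L.Relations k) (s : Fin k → ι),
        Structure.RelMap r (fun l => a (s l)) ↔ Structure.RelMap r (fun l => b (s l)) := by
  constructor
  · intro h
    refine ⟨fun i j => ?_, fun k r s => ?_⟩
    · exact iff_of_eq (congrFun (congrFun (congrArg Prod.fst h) i) j)
    · exact iff_of_eq (congrFun (congrFun (congrArg Prod.snd h) ⟨k, r⟩) s)
  · rintro ⟨h1, h2⟩
    refine Prod.ext ?_ ?_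
    · funext i j; exact propext (h1 i j)
    · funext r s; exact propext (h2 r.1 r.2 s)

lemma qtype_comp {N N' : Type} [L.Structure N] [L.Structure N'] {ι κ : Type}
    {a : ι → N} {b : ι → N'} (h : qtype (L := L) a = qtype (L := L) b) (s : κ → ι) :
    qtype (L := L) (fun i => a (s i)) = qtype (L := L) (fun i => b (s i)) := by
  rw [qtype_eq_iff] at h ⊢
  exact ⟨fun i j => h.1 _ _, fun k r t => h.2 k r _⟩

lemma qtype_emb {N N' : Type} [L.Structure N] [L.Structure N'] {ι : Type}
    (e : N ↪[L] N') (a : ι → N) : qtype (L := L) (fun i => e (a i)) = qtype (L := L) a := by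
  rw [qtype_eq_iff]
  exact ⟨fun i j => e.injective.eq_iff, fun k r t => e.map_rel r _⟩

lemma qtype_aut {N N' : Type} [L.Structure N] [L.Structure N'] {ι : Type}
    (e : N ≃[L] N') (a : ι → N) : qtype (L := L) (fun i => e (a i)) = qtype (L := L) a :=
  qtype_emb e.toEmbedding a

variable [L.IsRelational]

/-- The substructure on an arbitrary subset. -/
def relSub {N : Type} [L.Structure N] (s : Set N) : L.Substructure N :=
  ⟨s, fun f => isEmptyElim f⟩

lemma exists_iso {N N' : Type} [L.Structure N] [L.Structure N'] {ι : Type}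
    {a : ι → N} {b : ι → N'} (h : qtype (L := L) a = qtype (L := L) b) :
    ∃ φ : relSub (L := L) (Set.range a) ≃[L] relSub (L := L) (Set.range b),
      ∀ i, φ ⟨a i, ⟨i, rfl⟩⟩ = ⟨b i, ⟨i, rfl⟩⟩ := by
  rw [qtype_eq_iff] at h
  obtain ⟨h1, h2⟩ := h
  have ha : ∀ x : relSub (L := L) (Set.range a), ∃ i, a i = x := fun x => x.2
  have hb : ∀ x : relSub (L := L) (Set.range b), ∃ i, b i = x := fun x => x.2
  choose u hu using ha
  choose v hv using hb
  let φ : relSub (L := L) (Set.range a) ≃ relSub (L := L) (Set.range b) :=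
    { toFun := fun x => ⟨b (u x), ⟨_, rfl⟩⟩
      invFun := fun y => ⟨a (v y), ⟨_, rfl⟩⟩
      left_inv := fun x => by
        apply Subtype.ext
        refine Eq.trans ?_ (hu x)
        exact (h1 _ _).2 (hv _)
      right_inv := fun y => by
        apply Subtype.ext
        refine Eq.trans ?_ (hv y)
        exact (h1 _ _).1 (hu _) }
  refine ⟨⟨φ, fun f => isEmptyElim f, fun {k} r x => ?_⟩, fun i => ?_⟩
  · have h3 := h2 k r (fun l => u (x l))
    simp only [hu] at h3
    exact h3.symm
  · apply Subtype.ext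
    exact (h1 _ _).1 (hu _)

lemma relSub_finite {N : Type} [L.Structure N] {s : Set N} (hs : s.Finite) :
    Finite (relSub (L := L) s) := hs

lemma exists_aut {M : Type} [L.Structure M] (hhom : L.IsUltrahomogeneous M)
    {ι : Type} [Finite ι] {a b : ι → M} (h : qtype (L := L) a = qtype (L := L) b) :
    ∃ α : M ≃[L] M, ∀ i, α (a i) = b i := by
  obtain ⟨φ, hφ⟩ := exists_iso h
  haveI := relSub_finite (L := L) (Set.finite_range a)
  obtain ⟨α, hα⟩ := hhom (relSub (Set.range a)) Substructure.FG.of_finite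
    ((Substructure.subtype _).comp φ.toEmbedding)
  refine ⟨α, fun i => ?_⟩
  have h2 := DFunLike.congr_fun hα ⟨a i, ⟨i, rfl⟩⟩
  have h3 : (φ ⟨a i, ⟨i, rfl⟩⟩ : M) = α (a i) := h2
  rw [← h3, hφ]

lemma rigid_le {M : Type} [LinearOrder M] {ι : Type} [Finite ι] {s t : ι → M}
    (hr : Set.range s = Set.range t) (h : ∀ i j, s i ≤ s j ↔ t i ≤ t j) (i : ι) :
    s i ≤ t i := by
  have hs : ∀ x : Set.range s, ∃ i, s i = x := fun x => x.2
  choose u hu using hs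
  let σ : Set.range s → Set.range s := fun x => ⟨t (u x), hr ▸ ⟨_, rfl⟩⟩
  have hσ : StrictMono σ := by
    intro x y hxy
    have : s (u x) < s (u y) := by rw [hu, hu]; exact hxy
    change t (u x) < t (u y)
    rw [← not_le] at this ⊢
    rwa [← h]
  have h1 : (⟨s i, ⟨i, rfl⟩⟩ : Set.range s) ≤ σ ⟨s i, ⟨i, rfl⟩⟩ := hσ.le_apply
  have h2 : s i ≤ t (u ⟨s i, ⟨i, rfl⟩⟩) := h1
  refine h2.trans ((h _ _).1 (hu _).le)

lemma rigid {M : Type} [L.Structure M] (hord : Ordered L M) {ι : Type} [Finite ι] {s t : ι → M}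
    (hr : Set.range s = Set.range t) (h : qtype (L := L) s = qtype (L := L) t) : s = t := by
  classical
  obtain ⟨r, hlin⟩ := hord
  letI : LinearOrder M :=
    { le := fun a b => Structure.RelMap r ![a, b]
      le_refl := hlin.refl
      le_trans := hlin.trans
      le_antisymm := hlin.antisymm
      le_total := hlin.total
      toDecidableLE := Classical.decRel _ }
  have h1 : ∀ i j, s i ≤ s j ↔ t i ≤ t j := by
    intro i j
    have := (qtype_eq_iff.1 h).2 2 r ![i, j]
    have e1 : (fun l => s (![i, j] l)) = ![s i, s j] := by
      funext l; fin_cases l <;> rfl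
    have e2 : (fun l => t (![i, j] l)) = ![t i, t j] := by
      funext l; fin_cases l <;> rfl
    rw [e1, e2] at this
    exact this
  funext i
  exact le_antisymm (rigid_le hr h1 i) (rigid_le hr.symm (fun i j => (h1 i j).symm) i)

lemma mem_age {M : Type} [L.Structure M] {s : Set M} (hs : s.Finite) :
    (⟨relSub (L := L) s, inferInstance⟩ : CategoryTheory.Bundled.{0} L.Structure) ∈ L.age M := by
  haveI : Finite (relSub (L := L) s) := hs
  exact ⟨Structure.FG.of_finite, ⟨Substructure.subtype _⟩⟩

/-- Ramsey property for colourings of tuples. -/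
lemma ramsey_tuple {M : Type} [L.Structure M] (hord : Ordered L M)
    (hhom : L.IsUltrahomogeneous M) (hram : RamseyClass (L.age M))
    {ι : Type} [Finite ι] (p : ι → M) (C : Type*) [Finite C] (F : Set M) (hF : F.Finite) :
    ∃ F' : Set M, F'.Finite ∧ ∀ χ : (ι → M) → C, ∃ β : M ≃[L] M, (∀ x ∈ F, β x ∈ F') ∧
      ∀ a b : ι → M, (∀ i, a i ∈ F) → (∀ i, b i ∈ F) →
        qtype (L := L) a = qtype (L := L) p → qtype (L := L) b = qtype (L := L) p →
        χ (fun i => β (a i)) = χ (fun i => β (b i)) := by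
  classical
  rcases isEmpty_or_nonempty C with hC | hC
  · exact ⟨∅, Set.finite_empty, fun χ => (IsEmpty.false (χ p)).elim⟩
  obtain ⟨k, ⟨eC⟩⟩ := Finite.exists_equiv_fin C
  have hk : 1 ≤ k := by
    have : 0 < k := Fin.pos (eC hC.some)
    exact this
  obtain ⟨S, ⟨hSfg, ⟨j⟩⟩, hS⟩ := hram k hk _ (mem_age (L := L) hF) _
    (mem_age (L := L) (Set.finite_range p))
  haveI : Finite S := hSfg.finite
  refine ⟨Set.range j, Set.finite_range j, fun χ => ?_⟩
  have ht : ∀ Q : {Q : L.Substructure S // Nonempty (relSub (L := L) (Set.range p) ≃[L] Q)},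
      ∃ t : ι → S, Set.range t = (Q.1 : Set S) ∧ qtype (L := L) t = qtype (L := L) p := by
    rintro ⟨Q, ⟨φ⟩⟩
    refine ⟨fun i => (φ ⟨p i, ⟨i, rfl⟩⟩ : S), ?_, ?_⟩
    · ext x
      constructor
      · rintro ⟨i, rfl⟩
        exact (φ _).2
      · intro hx
        obtain ⟨⟨y, i, rfl⟩, hy⟩ := φ.surjective ⟨x, hx⟩
        exact ⟨i, congrArg Subtype.val hy⟩
    · refine (qtype_emb (Q.subtype.comp φ.toEmbedding)
        (fun i => (⟨p i, ⟨i, rfl⟩⟩ : relSub (L := L) (Set.range p)))).trans ?_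
      exact (qtype_emb (Substructure.subtype _) _).symm
  choose t ht1 ht2 using ht
  obtain ⟨e, he⟩ := hS (fun Q => eC (χ (fun i => j (t Q i))))
  haveI : Finite (relSub (L := L) F) := hF
  obtain ⟨β, hβ⟩ := hhom (relSub F) Substructure.FG.of_finite (j.comp e)
  have hβ' : ∀ x (hx : x ∈ F), β x = j (e ⟨x, hx⟩) := fun x hx =>
    (DFunLike.congr_fun hβ ⟨x, hx⟩).symm
  have key : ∀ a : ι → M, (∀ i, a i ∈ F) → qtype (L := L) a = qtype (L := L) p →
      ∃ Q : {Q : L.Substructure S // Nonempty (relSub (L := L) (Set.range p) ≃[L] Q)},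
        (Q.1 : Set S) ⊆ Set.range e ∧ (fun i => j (t Q i)) = fun i => β (a i) := by
    intro a haF hap
    let a' : ι → S := fun i => e ⟨a i, haF i⟩
    have ha' : qtype (L := L) a' = qtype (L := L) p := by
      refine (qtype_emb e (fun i => (⟨a i, haF i⟩ : relSub (L := L) F))).trans ?_
      rw [← hap]
      exact (qtype_emb (Substructure.subtype _) _).symm
    obtain ⟨φ, -⟩ := exists_iso ha'.symm
    refine ⟨⟨relSub (Set.range a'), ⟨φ⟩⟩, ?_, ?_⟩
    · rintro _ ⟨i, rfl⟩
      exact ⟨_, rfl⟩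
    · have h1 : (fun i => β (a i)) = fun i => j (a' i) := by
        funext i; exact hβ' _ (haF i)
      rw [h1]
      apply rigid (L := L) hord
      · change Set.range (j ∘ t _) = Set.range (j ∘ a')
        rw [Set.range_comp, Set.range_comp, ht1]
        rfl
      · rw [qtype_emb, qtype_emb, ht2, ha']
  refine ⟨β, fun x hx => ⟨_, (hβ' x hx).symm⟩, fun a b ha hb hap hbp => ?_⟩
  obtain ⟨Q₁, h1, h1e⟩ := key a ha hap
  obtain ⟨Q₂, h2, h2e⟩ := key b hb hbp
  have := eC.injective (he Q₁ Q₂ h1 h2)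
  rwa [h1e, h2e] at this

/-- Ramsey property for colourings of tuples, over constants. -/
lemma ramsey_const {M : Type} [L.Structure M] (hord : Ordered L M)
    (hhom : L.IsUltrahomogeneous M) (hram : RamseyClass (L.age M))
    {κ : Type} [Finite κ] (c : κ → M)
    {ι : Type} [Finite ι] (p : ι → M) (C : Type*) [Finite C] (F : Set M) (hF : F.Finite) :
    ∃ F' : Set M, F'.Finite ∧ ∀ χ : (ι → M) → C, ∃ β : M ≃[L] M, (∀ i, β (c i) = c i) ∧
      (∀ x ∈ F, β x ∈ F') ∧
      ∀ a b : ι → M, (∀ i, a i ∈ F) → (∀ i, b i ∈ F) →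
        qtype (L := L) (Sum.elim c a) = qtype (L := L) (Sum.elim c p) →
        qtype (L := L) (Sum.elim c b) = qtype (L := L) (Sum.elim c p) →
        χ (fun i => β (a i)) = χ (fun i => β (b i)) := by
  classical
  obtain ⟨F', hF', h⟩ := ramsey_tuple hord hhom hram (Sum.elim c p) C (F ∪ Set.range c)
    (hF.union (Set.finite_range c))
  have hγ : ∀ d : κ → M, ∃ γ : M ≃[L] M, (∃ γ' : M ≃[L] M, ∀ i, γ' (c i) = d i) →
      ∀ i, γ (c i) = d i := by
    intro d
    by_cases hd : ∃ γ' : M ≃[L] M, ∀ i, γ' (c i) = d i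
    · exact ⟨hd.choose, fun _ => hd.choose_spec⟩
    · exact ⟨Language.Equiv.refl L M, fun h => (hd h).elim⟩
  choose γ hγ using hγ
  refine ⟨⋃ d ∈ Set.pi Set.univ (fun _ : κ => F'), (γ d).symm '' F', ?_, fun χ => ?_⟩
  · exact (Set.Finite.pi' (fun _ => hF')).subset (by
      intro x hx; simpa using hx) |>.biUnion (fun d _ => hF'.image _)
  obtain ⟨β, hβF, hβ⟩ := h (fun t => χ (fun i => (γ (fun l => t (Sum.inl l))).symm (t (Sum.inr i))))
  have hd := hγ (fun l => β (c l)) ⟨β, fun _ => rfl⟩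
  refine ⟨(γ (fun l => β (c l))).symm.comp β, fun i => ?_, fun x hx => ?_, ?_⟩
  · change (γ (fun l => β (c l))).symm (β (c i)) = c i
    rw [← hd i]; simp
  · refine Set.mem_biUnion (x := fun l => β (c l)) ?_ ⟨β x, hβF x (Or.inl hx), rfl⟩
    intro l _
    exact hβF _ (Or.inr ⟨l, rfl⟩)
  · intro a b ha hb hap hbp
    refine hβ (Sum.elim c a) (Sum.elim c b) ?_ ?_ hap hbp
    · rintro (i | i)
      · exact Or.inr ⟨i, rfl⟩
      · exact Or.inl (ha i)
    · rintro (i | i)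
      · exact Or.inr ⟨i, rfl⟩
      · exact Or.inl (hb i)

/-- Iterated Ramsey property: simultaneously for finitely many types. -/
lemma ramsey_list {M : Type} [L.Structure M] (hfin : Finite (Σ i, L.Relations i))
    (hord : Ordered L M)
    (hhom : L.IsUltrahomogeneous M) (hram : RamseyClass (L.age M))
    {κ : Type} [Finite κ] (c : κ → M) (l : List (Σ k : ℕ, Fin k → M)) :
    ∀ (F : Set M), F.Finite →
    ∃ F' : Set M, F'.Finite ∧ ∀ f : M → M, ∃ β : M ≃[L] M, (∀ i, β (c i) = c i) ∧
      (∀ x ∈ F, β x ∈ F') ∧ ∀ p ∈ l,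
      ∀ a b : Fin p.1 → M, (∀ i, a i ∈ F) → (∀ i, b i ∈ F) →
        qtype (L := L) (Sum.elim c a) = qtype (L := L) (Sum.elim c p.2) →
        qtype (L := L) (Sum.elim c b) = qtype (L := L) (Sum.elim c p.2) →
        qtype (L := L) (fun i => f (β (a i))) = qtype (L := L) (fun i => f (β (b i))) := by
  induction l with
  | nil =>
    intro F hF
    exact ⟨F, hF, fun f => ⟨Language.Equiv.refl L M, fun _ => rfl, fun x hx => hx, by simp⟩⟩
  | cons p l ih =>
    intro F hF
    obtain ⟨F', hF', h'⟩ := ih F hF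
    obtain ⟨F'', hF'', h''⟩ := ramsey_const hord hhom hram c p.2 (QT L (Fin p.1)) F' hF'
    refine ⟨F'', hF'', fun f => ?_⟩
    obtain ⟨β₁, h1c, h1F, h1⟩ := h'' (fun t => qtype (L := L) (fun i => f (t i)))
    obtain ⟨β₂, h2c, h2F, h2⟩ := h' (fun x => f (β₁ x))
    have hq : ∀ {k : ℕ} (a : Fin k → M), qtype (L := L) (Sum.elim c (fun i => β₂ (a i)))
        = qtype (L := L) (Sum.elim c a) := by
      intro k a
      rw [← qtype_aut β₂ (Sum.elim c a)]
      congr 1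
      funext i
      rcases i with i | i
      · exact (h2c i).symm
      · rfl
    refine ⟨β₁.comp β₂, fun i => ?_, fun x hx => h1F _ (h2F x hx), ?_⟩
    · change β₁ (β₂ (c i)) = c i
      rw [h2c, h1c]
    · intro q hq' a b ha hb hap hbp
      rcases List.mem_cons.1 hq' with rfl | hq'
      · exact h1 (fun i => β₂ (a i)) (fun i => β₂ (b i)) (fun i => h2F _ (ha i))
          (fun i => h2F _ (hb i)) ((hq a).trans hap) ((hq b).trans hbp)
      · exact h2 q hq' a b ha hb hap hbp

/-- The limit type assignment. -/
lemma exists_limit {M : Type} [L.Structure M] (hfin : Finite (Σ i, L.Relations i))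
    (hord : Ordered L M)
    (hhom : L.IsUltrahomogeneous M) (hram : RamseyClass (L.age M))
    {κ : Type} [Finite κ] (c : κ → M) (f : M → M) :
    ∃ T : ∀ k : ℕ, (Fin k → M) → QT L (Fin k),
      (∀ k (a b : Fin k → M), qtype (L := L) (Sum.elim c a) = qtype (L := L) (Sum.elim c b) →
        T k a = T k b) ∧
      (∀ k l (a : Fin k → M) (b : Fin l → M), ∃ β : M ≃[L] M, (∀ i, β (c i) = c i) ∧
        T k a = qtype (L := L) (fun i => f (β (a i))) ∧
        T l b = qtype (L := L) (fun i => f (β (b i)))) := by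
  classical
  have h0 : ∀ I : Finset M × Finset (Σ k : ℕ, Fin k → M), ∃ β : M ≃[L] M,
      (∀ i, β (c i) = c i) ∧ ∀ p ∈ I.2,
      ∀ a b : Fin p.1 → M, (∀ i, a i ∈ I.1) → (∀ i, b i ∈ I.1) →
        qtype (L := L) (Sum.elim c a) = qtype (L := L) (Sum.elim c p.2) →
        qtype (L := L) (Sum.elim c b) = qtype (L := L) (Sum.elim c p.2) →
        qtype (L := L) (fun i => f (β (a i))) = qtype (L := L) (fun i => f (β (b i))) := by
    intro I
    obtain ⟨F', -, h⟩ := ramsey_list hfin hord hhom hram c I.2.toList (I.1 : Set M)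
      I.1.finite_toSet
    obtain ⟨β, h1, -, h2⟩ := h f
    exact ⟨β, h1, fun p hp => h2 p (by simpa using hp)⟩
  choose β hβc hβ using h0
  let U : Ultrafilter (Finset M × Finset (Σ k : ℕ, Fin k → M)) := Ultrafilter.of Filter.atTop
  have hU : (U : Filter (Finset M × Finset (Σ k : ℕ, Fin k → M))) ≤ Filter.atTop :=
    Ultrafilter.of_le _
  have hT : ∀ (k : ℕ) (a : Fin k → M), ∃ q : QT L (Fin k),
      ∀ᶠ I in (U : Filter _), q = qtype (L := L) (fun i => f (β I (a i))) := by
    intro k a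
    rw [← Ultrafilter.eventually_exists_iff]
    exact Filter.Eventually.of_forall fun I => ⟨_, rfl⟩
  choose T hT using hT
  refine ⟨T, fun k a b hab => ?_, fun k l a b => ?_⟩
  · have h1 : ∀ᶠ I in (U : Filter (Finset M × Finset (Σ k : ℕ, Fin k → M))),
        ((Finset.univ.image a ∪ Finset.univ.image b, {⟨k, a⟩}) :
          Finset M × Finset (Σ k : ℕ, Fin k → M)) ≤ I :=
      hU (Filter.eventually_ge_atTop _)
    obtain ⟨I, ⟨hI, hIa⟩, hIb⟩ := ((h1.and (hT k a)).and (hT k b)).exists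
    rw [hIa, hIb]
    refine hβ I ⟨k, a⟩ (hI.2 (by simp)) a b (fun i => hI.1 (by simp)) (fun i => hI.1 (by simp))
      rfl hab.symm
  · obtain ⟨I, hIa, hIb⟩ := ((hT k a).and (hT l b)).exists
    exact ⟨β I, hβc I, hIa, hIb⟩

/-- Realising a limit type assignment by a function. -/
lemma exists_realisation {M : Type} [L.Structure M] [Countable M] [Infinite M]
    (hhom : L.IsUltrahomogeneous M) (T : ∀ k : ℕ, (Fin k → M) → QT L (Fin k))
    (hT : ∀ k l (a : Fin k → M) (b : Fin l → M), ∃ h : M → M,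
        T k a = qtype (L := L) (fun i => h (a i)) ∧
        T l b = qtype (L := L) (fun i => h (b i))) :
    ∃ g : M → M, ∀ k (a : Fin k → M), qtype (L := L) (fun i => g (a i)) = T k a := by
  obtain ⟨e⟩ : Nonempty (M ≃ ℕ) := by
    obtain ⟨hd⟩ := nonempty_denumerable M
    exact ⟨Denumerable.eqv M⟩
  let A : ℕ → (M → M) → Prop := fun j h =>
    qtype (L := L) (fun i : Fin j => h (e.symm i)) = T j (fun i => e.symm i)
  have step : ∀ j (h : M → M), A j h → ∃ h', A (j+1) h' ∧
      ∀ i < j, h' (e.symm i) = h (e.symm i) := by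
    intro j h hA
    obtain ⟨h', h1, h2⟩ := hT j (j+1) (fun i => e.symm i) (fun i => e.symm i)
    obtain ⟨α, hα⟩ := exists_aut hhom (h1.symm.trans hA.symm)
    refine ⟨fun x => α (h' x), ?_, fun i hi => hα ⟨i, hi⟩⟩
    exact (qtype_aut α (fun i : Fin (j+1) => h' (e.symm i))).trans h2.symm
  have base : ∃ h, A 0 h := by
    obtain ⟨h', h1, h2⟩ := hT 0 0 (fun i => e.symm i) (fun i => e.symm i)
    exact ⟨h', h1.symm⟩
  choose! nx hnx1 hnx2 using step
  obtain ⟨h₀, hh₀⟩ := base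
  let H : ℕ → M → M := fun j => Nat.rec h₀ (fun j h => nx j h) j
  have HA : ∀ j, A j (H j) := by
    intro j
    induction j with
    | zero => exact hh₀
    | succ j ih => exact hnx1 j _ ih
  have Hst : ∀ i d, H (i + 1 + d) (e.symm i) = H (i + 1) (e.symm i) := by
    intro i d
    induction d with
    | zero => rfl
    | succ d ih =>
      rw [← ih]
      exact hnx2 (i + 1 + d) _ (HA _) i (by omega)
  refine ⟨fun x => H (e x + 1) x, fun k a => ?_⟩
  obtain ⟨j, hj⟩ : ∃ j, ∀ i, e (a i) < j := by
    refine ⟨(Finset.univ.sup fun i => e (a i)) + 1, fun i => ?_⟩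
    exact Nat.lt_succ_of_le (Finset.le_sup (f := fun i => e (a i)) (Finset.mem_univ i))
  obtain ⟨h', h1, h2⟩ := hT k j a (fun i => e.symm i)
  have h3 := qtype_comp ((HA j).trans h2) (fun i : Fin k => (⟨e (a i), hj i⟩ : Fin j))
  simp only [Equiv.symm_apply_apply] at h3
  rw [h1, ← h3]
  congr 1
  funext i
  have := Hst (e (a i)) (j - (e (a i) + 1))
  rw [show e (a i) + 1 + (j - (e (a i) + 1)) = j by have := hj i; omega] at this
  simpa using this.symm

lemma qtype_of_sameType {M : Type} [L.Structure M] {n : ℕ} (c : Fin n → M) {k : ℕ}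
    (a b : Fin k → M)
    (h : @SameType (L[[Fin n]]) M (withConstantsStruct L c) k a b) :
    qtype (L := L) (Sum.elim c a) = qtype (L := L) (Sum.elim c b) := by
  letI := constantsOn.structure c
  have h' : ∀ φ : (L[[Fin n]]).Formula (Fin k), φ.Realize a ↔ φ.Realize b := h
  let tm : Fin n ⊕ Fin k → (L[[Fin n]]).Term (Fin k) :=
    Sum.elim (fun i => (L.con i).term) (fun i => Term.var i)
  have htm : ∀ (x : Fin k → M) (i : Fin n ⊕ Fin k), (tm i).realize x = Sum.elim c x i := by
    intro x i
    rcases i with i | i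
    · exact Term.realize_constants
    · rfl
  rw [qtype_eq_iff]
  refine ⟨fun i j => ?_, fun m r s => ?_⟩
  · have := h' ((tm i).equal (tm j))
    simpa only [Formula.realize_equal, htm] using this
  · have := h' (Relations.formula (L := L[[Fin n]]) (Sum.inl r) (fun l => tm (s l)))
    have key : ∀ x : Fin k → M, (Relations.formula (L := L[[Fin n]]) (Sum.inl r)
        (fun l => tm (s l))).Realize x ↔ Structure.RelMap r (fun l => Sum.elim c x (s l)) := by
      intro x
      refine Formula.realize_rel.trans ?_
      simp only [htm]
      rfl
    exact (key a).symm.trans (this.trans (key b))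

lemma sameType_of_aut {M : Type} [L.Structure M] {k : ℕ} (a b : Fin k → M) (α : M ≃[L] M)
    (h : ∀ i, α (a i) = b i) : SameType L M a b := by
  intro φ
  have : b = α ∘ a := by funext i; exact (h i).symm
  rw [this, StrongHomClass.realize_formula]

end Helpers

end PaperDef

namespace PaperDef
/-- **Lemma 7 of the paper (canonisation lemma).**  Let `Δ` (an `L`-structure on `M`) be
countably infinite, ordered, homogeneous and Ramsey with finite relational signature, let
`f : M → M` and let `c₁, …, cₙ ∈ M`.  Then `f` generates over `Δ` a function which agrees
with `f` on `{c₁, …, cₙ}` and is canonical as a function from `(Δ, c₁, …, cₙ)` to `Δ`. -/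
theorem generates_canonical_function_with_constants
    (L : Language) (M : Type) [L.Structure M] [Countable M] [Infinite M]
    (hrel : ∀ i, IsEmpty (L.Functions i)) (hfin : Finite (Σ i, L.Relations i))
    (hord : Ordered L M) (hhom : L.IsUltrahomogeneous M) (hram : RamseyClass (L.age M))
    (f : M → M) (n : ℕ) (c : Fin n → M) :
    ∃ g : M → M, GeneratesOverMonoid L M f g ∧ (∀ i, g (c i) = f (c i)) ∧
      @Canonical (L[[Fin n]]) L M M (withConstantsStruct L c) _ g := by
  haveI : L.IsRelational := hrel
  obtain ⟨T, hT1, hT2⟩ := exists_limit hfin hord hhom hram c f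
  obtain ⟨g₀, hg₀⟩ := exists_realisation hhom T (fun k l a b => by
    obtain ⟨β, -, h1, h2⟩ := hT2 k l a b
    exact ⟨fun x => f (β x), h1, h2⟩)
  obtain ⟨α, hα⟩ : ∃ α : M ≃[L] M, ∀ i, α (g₀ (c i)) = f (c i) := by
    obtain ⟨β, hβ, h1, -⟩ := hT2 n n c c
    simp only [hβ] at h1
    exact exists_aut hhom ((hg₀ n c).trans h1)
  have hg : ∀ k (a : Fin k → M), qtype (L := L) (fun i => α (g₀ (a i))) = T k a :=
    fun k a => (qtype_aut α _).trans (hg₀ k a)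
  refine ⟨fun x => α (g₀ x), ?_, hα, ?_⟩
  · intro F hF
    haveI : Finite F := hF
    obtain ⟨k, ⟨eF⟩⟩ := Finite.exists_equiv_fin F
    let a : Fin k → M := fun i => (eF.symm i : M)
    obtain ⟨β, -, h1, -⟩ := hT2 k k a a
    obtain ⟨γ, hγ⟩ := exists_aut hhom (h1.symm.trans (hg k a).symm)
    refine ⟨γ ∘ (f ∘ β), .comp (.auto γ) (.comp .base (.auto β)), fun x hx => ?_⟩
    have := hγ (eF ⟨x, hx⟩)
    simpa [a] using this
  · intro k a b hab
    have h1 := hT1 k a b (qtype_of_sameType c a b hab)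
    obtain ⟨γ, hγ⟩ := exists_aut hhom ((hg k a).trans (h1.trans (hg k b).symm))
    exact sameType_of_aut _ _ γ hγ

end PaperDef
end

section
/- Let Θ be a structure with finite relational signature that is a reduct of a countably infinite ordered homogeneous Ramsey structure with finite relational signature. Then there are only finitely many closed transformation monoids that are minimal above End(Θ), and every closed transformation monoid properly containing End(Θ) contains one that is minimal above End(Θ). -/
open FirstOrder FirstOrder.Language

namespace PaperDef
namespace Aux

/-! ### Generalised relations and atomic types -/

section Basic

/-- Indices of the generalised relations: `none` is equality. -/
abbrev Idx (L : Language) := Option (Σ k, L.Relations k)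

/-- The arity of a generalised relation. -/
def ar {L : Language} : Idx L → ℕ
  | none => 2
  | some s => s.1

/-- The interpretation of a generalised relation. -/
def rel {L : Language} {A : Type} [L.Structure A] : (i : Idx L) → (Fin (ar i) → A) → Prop
  | none, x => x (0 : Fin 2) = x (1 : Fin 2)
  | some s, x => Structure.RelMap s.2 x

/-- Atomic types of tuples indexed by `X`. -/
abbrev Atp (L : Language) (X : Type) := ∀ i : Idx L, (Fin (ar i) → X) → Prop

/-- The atomic type of a tuple. -/
def atp (L : Language) {A X : Type} [L.Structure A] (a : X → A) : Atp L X :=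
  fun i s => rel i (a ∘ s)

variable {L : Language} {A B X Y : Type} [L.Structure A] [L.Structure B]

lemma rel_emb (φ : A ↪[L] B) (i : Idx L) (x : Fin (ar i) → A) : rel i (φ ∘ x) ↔ rel i x := by
  cases i with
  | none => exact φ.injective.eq_iff
  | some s => exact φ.map_rel s.2 x

lemma rel_aut (φ : A ≃[L] B) (i : Idx L) (x : Fin (ar i) → A) : rel i (φ ∘ x) ↔ rel i x :=
  rel_emb φ.toEmbedding i x

lemma atp_emb (φ : A ↪[L] B) (a : X → A) : atp L (φ ∘ a) = atp L a := by
  funext i s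
  exact propext (rel_emb φ i (a ∘ s))

lemma atp_aut (φ : A ≃[L] B) (a : X → A) : atp L (φ ∘ a) = atp L a :=
  atp_emb φ.toEmbedding a

lemma atp_comp {a : X → A} {b : X → B} (h : atp L a = atp L b) (s : Y → X) :
    atp L (a ∘ s) = atp L (b ∘ s) := by
  funext i t
  exact congrFun (congrFun h i) (s ∘ t)

lemma atp_eq_iff {a : X → A} {b : X → B} (h : atp L a = atp L b) (x y : X) :
    a x = a y ↔ b x = b y := by
  have := congrFun (congrFun h none) (![x, y] : Fin 2 → X)
  exact iff_of_eq this

lemma atp_rel_iff {a : X → A} {b : X → B} (h : atp L a = atp L b) {n : ℕ} (r : L.Relations n)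
    (s : Fin n → X) : Structure.RelMap r (a ∘ s) ↔ Structure.RelMap r (b ∘ s) :=
  iff_of_eq (congrFun (congrFun h (some ⟨n, r⟩)) s)

/-- In a relational language every set is a substructure. -/
def sub (hL : ∀ i, IsEmpty (L.Functions i)) (s : Set A) : L.Substructure A where
  carrier := s
  fun_mem := fun f => (hL _).elim f

lemma exists_iso (hL : ∀ i, IsEmpty (L.Functions i)) {a : X → A} {b : X → B}
    (h : atp L a = atp L b) :
    ∃ u : (sub hL (Set.range a)) ≃[L] (sub hL (Set.range b)),
      ∀ x, u ⟨a x, ⟨x, rfl⟩⟩ = ⟨b x, ⟨x, rfl⟩⟩ := by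
  classical
  have key : ∀ {A B : Type} [L.Structure A] [L.Structure B] {a : X → A} {b : X → B}
      (_ : atp L a = atp L b) (x : X),
      b (Classical.choose (⟨x, rfl⟩ : a x ∈ Set.range a)) = b x := by
    intro A B _ _ a b h x
    exact (atp_eq_iff h _ _).1 (Classical.choose_spec (⟨x, rfl⟩ : a x ∈ Set.range a))
  let e : (sub hL (Set.range a)) ≃ (sub hL (Set.range b)) :=
    { toFun := fun y => ⟨b (Classical.choose y.2), ⟨_, rfl⟩⟩
      invFun := fun y => ⟨a (Classical.choose y.2), ⟨_, rfl⟩⟩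
      left_inv := by
        rintro ⟨_, x, rfl⟩
        apply Subtype.ext
        exact (key h.symm _).trans (key (h.trans h.symm) x)
      right_inv := by
        rintro ⟨_, x, rfl⟩
        apply Subtype.ext
        exact (key h _).trans (key (h.symm.trans h) x) }
  have he : ∀ x, e ⟨a x, ⟨x, rfl⟩⟩ = ⟨b x, ⟨x, rfl⟩⟩ := by
    intro x
    apply Subtype.ext
    exact key h x
  refine ⟨{ toEquiv := e, map_fun' := fun f => (hL _).elim f, map_rel' := ?_ }, he⟩
  intro n r x
  have hx : ∀ j, ∃ t, x j = ⟨a t, ⟨t, rfl⟩⟩ := by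
    intro j
    obtain ⟨t, ht⟩ := (x j).2
    exact ⟨t, Subtype.ext ht.symm⟩
  choose t ht using hx
  have hx' : x = fun j => ⟨a (t j), ⟨t j, rfl⟩⟩ := funext ht
  subst hx'
  have h1 : (e.toFun ∘ fun j => (⟨a (t j), ⟨t j, rfl⟩⟩ : sub hL (Set.range a)))
      = fun j => ⟨b (t j), ⟨t j, rfl⟩⟩ := funext fun j => he (t j)
  rw [h1]
  exact (atp_rel_iff h r t).symm

lemma exists_aut (hL : ∀ i, IsEmpty (L.Functions i)) (hhom : L.IsUltrahomogeneous A)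
    [Finite X] {a b : X → A} (h : atp L a = atp L b) :
    ∃ α : A ≃[L] A, ∀ x, α (a x) = b x := by
  obtain ⟨u, hu⟩ := exists_iso hL h
  have hfin : Finite (sub hL (Set.range a)) := (Set.finite_range a).to_subtype
  obtain ⟨g, hg⟩ := hhom (sub hL (Set.range a)) Substructure.FG.of_finite
    ((sub hL (Set.range b)).subtype.comp u.toEmbedding)
  refine ⟨g, fun x => ?_⟩
  have := DFunLike.congr_fun hg (⟨a x, ⟨x, rfl⟩⟩ : sub hL (Set.range a))
  have h2 : g (a x) = (u ⟨a x, ⟨x, rfl⟩⟩ : sub hL (Set.range b)).1 := this.symm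
  rw [h2, hu]

/-- Finite ordered structures embedding in an ordered structure are rigid. -/
lemma rigid {M S : Type} [L.Structure M] [L.Structure S] (hord : Ordered L M) (ι : S ↪[L] M)
    (hA : Nonempty (A ↪[L] S)) [Finite A] (u v : A ≃[L] B) : u = v := by
  classical
  obtain ⟨r, hr⟩ := hord
  obtain ⟨j⟩ := hA
  let φ : A ↪[L] M := ι.comp j
  let lo : LinearOrder M :=
    { le := fun a b => Structure.RelMap r ![a, b]
      le_refl := hr.refl
      le_trans := hr.trans
      le_antisymm := hr.antisymm
      le_total := hr.total
      toDecidableLE := Classical.decRel _ }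
  letI : LinearOrder A := LinearOrder.lift' φ φ.injective
  have hle : ∀ x y : A, x ≤ y ↔ Structure.RelMap r ![x, y] := by
    intro x y
    have h1 : (φ ∘ ![x, y]) = ![φ x, φ y] := by
      funext k; fin_cases k <;> rfl
    rw [← φ.map_rel r ![x, y], h1]
    exact Iff.rfl
  have hw : ∀ w : A ≃[L] A, ∀ x, w x = x := by
    intro w
    let o : A ≃o A :=
      { toEquiv := w.toEquiv
        map_rel_iff' := by
          intro x y
          have h1 : (w ∘ ![x, y]) = ![w x, w y] := by
            funext k; fin_cases k <;> rfl
          rw [hle x y, ← w.map_rel r ![x, y], h1]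
          exact hle _ _ }
    intro x
    have : o = OrderIso.refl A := Subsingleton.elim _ _
    exact DFunLike.congr_fun this x
  ext x
  have := hw (v.symm.comp u) x
  have h2 : v (v.symm (u x)) = v x := congrArg v this
  simpa using h2

end Basic

/-! ### The Ramsey property with constants -/

section Ramsey

variable {L : Language} {M : Type} [L.Structure M]

lemma ramsey_single (hL : ∀ i, IsEmpty (L.Functions i))
    (hord : Ordered L M) (hhom : L.IsUltrahomogeneous M) (hram : RamseyClass (L.age M))
    {n k : ℕ} (c : Fin n → M) (t : Atp L (Fin n ⊕ Fin k)) (H : Set M) (hH : H.Finite) :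
    ∃ H' : Set M, H'.Finite ∧ ∀ χ : (Fin k → M) → Prop, ∃ β : M ≃[L] M,
      (∀ j, β (c j) = c j) ∧ (∀ x ∈ H, β x ∈ H') ∧
      ∀ a b : Fin k → M, (∀ j, a j ∈ H) → (∀ j, b j ∈ H) →
        atp L (Sum.elim c a) = t → atp L (Sum.elim c b) = t → (χ (β ∘ a) ↔ χ (β ∘ b)) := by
  classical
  by_cases hex : ∃ a : Fin k → M, (∀ j, a j ∈ H) ∧ atp L (Sum.elim c a) = t
  swap
  · exact ⟨H, hH, fun χ => ⟨Language.Equiv.refl L M, fun _ => rfl, fun x hx => hx,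
      fun a b ha _ hta _ => (hex ⟨a, ha, hta⟩).elim⟩⟩
  obtain ⟨a0, ha0, rfl⟩ := hex
  have : Finite H := hH.to_subtype
  -- the two structures
  let h : Fin n ⊕ H → M := Sum.elim c (fun x => x.1)
  let HS : L.Substructure M := sub hL (Set.range h)
  let p : Fin n ⊕ Fin k → M := Sum.elim c a0
  let P : L.Substructure M := sub hL (Set.range p)
  have finHS : Finite HS := (Set.finite_range h).to_subtype
  have finP : Finite P := (Set.finite_range p).to_subtype
  obtain ⟨S, hS, hSram⟩ := hram 2 (by norm_num) (CategoryTheory.Bundled.of HS)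
    ⟨Structure.FG.of_finite (M := HS), ⟨HS.subtype⟩⟩ (CategoryTheory.Bundled.of P)
    ⟨Structure.FG.of_finite (M := P), ⟨P.subtype⟩⟩
  obtain ⟨hSfg, ⟨ι⟩⟩ := hS
  have finS : Finite S := hSfg.finite
  -- moving copies of `c` back to `c`
  have hσ : ∀ c' : Fin n → M, ∃ τ : M ≃[L] M, atp L c' = atp L c → ∀ j, τ (c' j) = c j := by
    intro c'
    by_cases hc : atp L c' = atp L c
    · obtain ⟨τ, hτ⟩ := exists_aut hL hhom hc
      exact ⟨τ, fun _ => hτ⟩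
    · exact ⟨Language.Equiv.refl L M, fun h => (hc h).elim⟩
  choose σ hσ using hσ
  refine ⟨Set.range (fun z : (Fin n → S) × S => σ (ι ∘ z.1) (ι z.2)), Set.finite_range _, ?_⟩
  intro χ
  let q : {Q : L.Substructure S // Nonempty (P ≃[L] Q)} → Fin n ⊕ Fin k → M :=
    fun Q x => ι ((Classical.choice Q.2) ⟨p x, ⟨x, rfl⟩⟩).1
  obtain ⟨e, he⟩ := hSram (fun Q =>
    if χ (σ (q Q ∘ Sum.inl) ∘ (q Q ∘ Sum.inr)) then (0 : Fin 2) else 1)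
  let e' : HS ↪[L] S := e
  let h0 : Fin n ⊕ H → HS := fun x => ⟨h x, ⟨x, rfl⟩⟩
  let es : Fin n ⊕ H → S := e' ∘ h0
  have hes : atp L h = atp L (ι ∘ es) := by
    have h1 : atp L (HS.subtype ∘ h0) = atp L h0 := atp_emb HS.subtype h0
    have h2 : atp L (ι ∘ es) = atp L h0 := (atp_emb ι es).trans (atp_emb e' h0)
    exact h1.trans h2.symm
  obtain ⟨α, hα⟩ := exists_aut hL hhom hes
  have hαc : ∀ j, α (c j) = ι (es (Sum.inl j)) := fun j => hα (Sum.inl j)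
  have hαH : ∀ x (hx : x ∈ H), α x = ι (es (Sum.inr ⟨x, hx⟩)) := fun x hx => hα (Sum.inr ⟨x, hx⟩)
  let cs : Fin n → S := fun j => es (Sum.inl j)
  have hcs : α ∘ c = ι ∘ cs := funext hαc
  have hσc : ∀ j, σ (ι ∘ cs) (ι (cs j)) = c j := by
    apply hσ
    rw [← hcs, atp_aut]
  refine ⟨(σ (ι ∘ cs)).comp α, ?_, ?_, ?_⟩
  · intro j
    change σ (ι ∘ cs) (α (c j)) = c j
    rw [hαc]
    exact hσc j
  · intro x hx
    refine ⟨(cs, es (Sum.inr ⟨x, hx⟩)), ?_⟩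
    change σ (ι ∘ cs) _ = σ (ι ∘ cs) (α x)
    rw [hαH x hx]
  -- copies of `P` inside the copy of `HS`
  have main : ∀ a : Fin k → M, (∀ j, a j ∈ H) → atp L (Sum.elim c a) = atp L p →
      ∃ Q : {Q : L.Substructure S // Nonempty (P ≃[L] Q)}, (Q.1 : Set S) ⊆ Set.range e ∧
        (σ (q Q ∘ Sum.inl) ∘ (q Q ∘ Sum.inr)) = (σ (ι ∘ cs)).comp α ∘ a := by
    intro a ha hta
    let s : Fin n ⊕ Fin k → Fin n ⊕ H := Sum.map id (fun j => ⟨a j, ha j⟩)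
    have hs : h ∘ s = Sum.elim c a := by
      funext x
      cases x <;> rfl
    have hty : atp L p = atp L (es ∘ s) := by
      rw [← hta, ← hs, ← atp_emb ι (es ∘ s)]
      exact atp_comp hes s
    obtain ⟨u, hu⟩ := exists_iso hL hty
    let Q : {Q : L.Substructure S // Nonempty (P ≃[L] Q)} :=
      ⟨sub hL (Set.range (es ∘ s)), ⟨u⟩⟩
    have hq : q Q = ι ∘ es ∘ s := by
      funext x
      have : Classical.choice Q.2 = u :=
        rigid (S := M) hord (Language.Embedding.refl L M) ⟨P.subtype⟩ _ _
      change ι ((Classical.choice Q.2) ⟨p x, ⟨x, rfl⟩⟩).1 = _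
      rw [this]
      exact congrArg (fun z : (sub hL (Set.range (es ∘ s))) => ι z.1) (hu x)
    refine ⟨Q, ?_, ?_⟩
    · rintro _ ⟨x, rfl⟩
      exact ⟨h0 (s x), rfl⟩
    · rw [hq]
      funext j
      change σ (ι ∘ cs) (ι (es (Sum.inr ⟨a j, ha j⟩))) = σ (ι ∘ cs) (α (a j))
      rw [hαH _ (ha j)]
  intro a b ha hb hta htb
  obtain ⟨Q₁, hQ₁, hq₁⟩ := main a ha hta
  obtain ⟨Q₂, hQ₂, hq₂⟩ := main b hb htb
  have := he Q₁ Q₂ hQ₁ hQ₂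
  simp only [hq₁, hq₂] at this
  by_cases h1 : χ ((σ (ι ∘ cs)).comp α ∘ a) <;> by_cases h2 : χ ((σ (ι ∘ cs)).comp α ∘ b)
  · exact ⟨fun _ => h2, fun _ => h1⟩
  · simp [h1, h2] at this
  · simp [h1, h2] at this
  · exact ⟨fun h => (h1 h).elim, fun h => (h2 h).elim⟩

lemma sum_elim_comp {X Y A B : Type} (f : A → B) (a : X → A) (b : Y → A) :
    f ∘ Sum.elim a b = Sum.elim (f ∘ a) (f ∘ b) := by
  funext x
  cases x <;> rfl

/-- Automorphisms fixing `c` preserve types over `c`. -/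
lemma atp_fix {n : ℕ} {Y : Type} {c : Fin n → M} (β : M ≃[L] M) (hβ : ∀ j, β (c j) = c j)
    (a : Y → M) : atp L (Sum.elim c (β ∘ a)) = atp L (Sum.elim c a) := by
  have h : β ∘ Sum.elim c a = Sum.elim c (β ∘ a) := by
    rw [sum_elim_comp]
    congr 1
    exact funext hβ
  rw [← h, atp_aut]

/-- A task: make colours of tuples of a given type constant. -/
abbrev Task (L : Language) (n : ℕ) := Σ i : Idx L, Atp L (Fin n ⊕ Fin (ar i))

lemma ramsey_list (hL : ∀ i, IsEmpty (L.Functions i))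
    (hord : Ordered L M) (hhom : L.IsUltrahomogeneous M) (hram : RamseyClass (L.age M))
    {n : ℕ} (c : Fin n → M) (f : M → M) (T : List (Task L n)) :
    ∀ H : Set M, H.Finite → ∃ β : M ≃[L] M, (∀ j, β (c j) = c j) ∧
      ∀ τ ∈ T, ∀ a b : Fin (ar τ.1) → M, (∀ j, a j ∈ H) → (∀ j, b j ∈ H) →
        atp L (Sum.elim c a) = τ.2 → atp L (Sum.elim c b) = τ.2 →
        (rel τ.1 (f ∘ β ∘ a) ↔ rel τ.1 (f ∘ β ∘ b)) := by
  induction T with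
  | nil => exact fun H _ => ⟨Language.Equiv.refl L M, fun _ => rfl, by simp⟩
  | cons τ T ih =>
    intro H hH
    obtain ⟨H', hH', hs⟩ := ramsey_single hL hord hhom hram c τ.2 H hH
    obtain ⟨β', hβ', hT⟩ := ih H' hH'
    obtain ⟨β, hβ, hβH, hτ⟩ := hs (fun a => rel τ.1 (f ∘ β' ∘ a))
    refine ⟨β'.comp β, fun j => ?_, ?_⟩
    · change β' (β (c j)) = c j
      rw [hβ, hβ']
    · intro τ' hτ' a b ha hb hta htb
      rcases List.mem_cons.1 hτ' with rfl | hmem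
      · exact hτ a b ha hb hta htb
      · exact hT τ' hmem (β ∘ a) (β ∘ b) (fun j => hβH _ (ha j)) (fun j => hβH _ (hb j))
          (by rw [atp_fix β hβ, hta]) (by rw [atp_fix β hβ, htb])

/-- A behaviour: for each generalised relation, the set of types mapped into it. -/
abbrev Beh (L : Language) (n : ℕ) := ∀ i : Idx L, Atp L (Fin n ⊕ Fin (ar i)) → Prop

/-- `g` has behaviour `b` over `c` on the set `H`. -/
def HasBeh {n : ℕ} (c : Fin n → M) (b : Beh L n) (g : M → M) (H : Set M) : Prop :=
  ∀ (i : Idx L) (a : Fin (ar i) → M), (∀ j, a j ∈ H) →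
    (rel i (g ∘ a) ↔ b i (atp L (Sum.elim c a)))

lemma exists_beh (hL : ∀ i, IsEmpty (L.Functions i)) (hLfin : Finite (Σ i, L.Relations i))
    (hord : Ordered L M) (hhom : L.IsUltrahomogeneous M) (hram : RamseyClass (L.age M))
    {n : ℕ} (c : Fin n → M) (f : M → M) (H : Set M) (hH : H.Finite) :
    ∃ β : M ≃[L] M, (∀ j, β (c j) = c j) ∧ ∃ b : Beh L n, HasBeh c b (f ∘ β) H := by
  classical
  cases nonempty_fintype (Task L n)
  obtain ⟨β, hβ, hT⟩ := ramsey_list hL hord hhom hram c f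
    (Finset.univ : Finset (Task L n)).toList H hH
  refine ⟨β, hβ, fun i t => ∃ a : Fin (ar i) → M, (∀ j, a j ∈ H) ∧
    atp L (Sum.elim c a) = t ∧ rel i (f ∘ β ∘ a), ?_⟩
  intro i a ha
  constructor
  · intro h
    exact ⟨a, ha, rfl, h⟩
  · rintro ⟨a', ha', ht, h⟩
    exact (hT ⟨i, atp L (Sum.elim c a)⟩ (by simp) a' a ha' ha ht rfl).1 h

end Ramsey

/-! ### Canonical functions -/

section Canonical

variable {L : Language} {M : Type} [L.Structure M]

lemma beh_atp {n : ℕ} {c c' : Fin n → M} {b : Beh L n} {g g' : M → M} {H H' : Set M}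
    (h : HasBeh c b g H) (h' : HasBeh c' b g' H') {X : Type} {a a' : X → M}
    (ha : ∀ x, a x ∈ H) (ha' : ∀ x, a' x ∈ H')
    (hty : atp L (Sum.elim c a) = atp L (Sum.elim c' a')) :
    atp L (g ∘ a) = atp L (g' ∘ a') := by
  funext i s
  apply propext
  have key : ∀ (d : Fin n → M) (z : X → M),
      Sum.elim d (z ∘ s) = Sum.elim d z ∘ Sum.map id s := by
    intro d z
    funext x
    cases x <;> rfl
  have h1 := h i (a ∘ s) (fun j => ha _)
  have h2 := h' i (a' ∘ s) (fun j => ha' _)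
  rw [key] at h1 h2
  rw [atp_comp hty] at h1
  exact h1.trans h2.symm

lemma exists_global (hL : ∀ i, IsEmpty (L.Functions i)) (hLfin : Finite (Σ i, L.Relations i))
    [Countable M] [Nonempty M]
    (hord : Ordered L M) (hhom : L.IsUltrahomogeneous M) (hram : RamseyClass (L.age M))
    {N : Set (M → M)} (hN : IsClosedTransMonoid N) (hAut : ∀ α : M ≃[L] M, (α : M → M) ∈ N)
    {n : ℕ} (c : Fin n → M) {f : M → M} (hf : f ∈ N) :
    ∃ (b : Beh L n) (g : M → M), g ∈ N ∧ HasBeh c b g Set.univ ∧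
      ∃ γ : M ≃[L] M, ∀ j, g (c j) = γ (f (c j)) := by
  classical
  obtain ⟨e, he⟩ := exists_surjective_nat M
  let Hs : ℕ → Set M := fun m => e '' {j | j < m}
  have hHfin : ∀ m, (Hs m).Finite := fun m => (Set.finite_lt_nat m).image e
  have hHmono : ∀ {m m'}, m ≤ m' → Hs m ⊆ Hs m' := by
    rintro m m' hm _ ⟨j, hj, rfl⟩
    exact ⟨j, lt_of_lt_of_le hj hm, rfl⟩
  have hHcof : ∀ F : Set M, F.Finite → ∃ m, F ⊆ Hs m := by
    intro F hF
    induction F, hF using Set.Finite.induction_on with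
    | empty => exact ⟨0, Set.empty_subset _⟩
    | insert _ _ ih =>
      obtain ⟨m, hm⟩ := ih
      rename_i x F _ _
      obtain ⟨j, rfl⟩ := he x
      refine ⟨max m (j + 1), Set.insert_subset ⟨j, ?_, rfl⟩ (hm.trans (hHmono (le_max_left _ _)))⟩
      exact lt_of_lt_of_le (Nat.lt_succ_self j) (le_max_right _ _)
  choose β hβ b hb using fun m => exists_beh hL hLfin hord hhom hram c f (Hs m) (hHfin m)
  obtain ⟨b0, hb0⟩ := Finite.exists_infinite_fiber b
  have hcof : ∀ m, ∃ m', m ≤ m' ∧ b m' = b0 := by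
    intro m
    obtain ⟨m', hm', hlt⟩ := (Set.infinite_coe_iff.1 hb0).exists_gt m
    exact ⟨m', hlt.le, hm'⟩
  let Good : ℕ → Set (M → M) := fun m =>
    {k | k ∈ N ∧ HasBeh c b0 k (Hs m) ∧ ∃ γ : M ≃[L] M, ∀ j, k (c j) = γ (f (c j))}
  have hGood : ∀ m, ∃ k, k ∈ Good m := by
    intro m
    obtain ⟨m', hm, hm'⟩ := hcof m
    refine ⟨f ∘ β m', hN.2.1 _ _ hf (hAut _), ?_, Language.Equiv.refl L M, fun j => ?_⟩
    · have := hb m'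
      rw [hm'] at this
      exact fun i a ha => this i a (fun j => hHmono hm (ha j))
    · change f (β m' (c j)) = f (c j)
      rw [hβ]
  have hstep : ∀ m (k : Good m), ∃ k' : Good (m + 1), ∀ x ∈ Hs m, k'.1 x = k.1 x := by
    rintro m ⟨k, hkN, hkb, hkγ⟩
    obtain ⟨k', hkN', hkb', γ', hγ'⟩ := hGood (m + 1)
    have : Finite (Hs m) := (hHfin m).to_subtype
    have hty := beh_atp (a := fun x : Hs m => x.1) (a' := fun x : Hs m => x.1) hkb' hkb
      (fun x => hHmono (Nat.le_succ m) x.2) (fun x => x.2) rfl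
    obtain ⟨α, hα⟩ := exists_aut hL hhom hty
    refine ⟨⟨α ∘ k', hN.2.1 _ _ (hAut α) hkN', ?_, α.comp γ', fun j => ?_⟩, ?_⟩
    · intro i a ha
      rw [← hkb' i a ha]
      exact rel_aut α i (k' ∘ a)
    · change α (k' (c j)) = α (γ' (f (c j)))
      rw [hγ']
    · intro x hx
      exact hα ⟨x, hx⟩
  choose step hstep using hstep
  obtain ⟨k0, hk0⟩ := hGood 0
  let seq : ∀ m, Good m := fun m => Nat.rec ⟨k0, hk0⟩ (fun m k => step m k) m
  have hseq : ∀ m, ∀ x ∈ Hs m, (seq (m + 1)).1 x = (seq m).1 x := fun m => hstep m (seq m)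
  have hseq' : ∀ m d, ∀ x ∈ Hs m, (seq (m + d)).1 x = (seq m).1 x := by
    intro m d
    induction d with
    | zero => exact fun _ _ => rfl
    | succ d ih =>
      intro x hx
      rw [← ih x hx]
      exact hseq (m + d) x (hHmono (Nat.le_add_right m d) hx)
  choose idx hidx using he
  let g : M → M := fun x => (seq (idx x + 1)).1 x
  have hg : ∀ m, ∀ x ∈ Hs m, g x = (seq m).1 x := by
    intro m x hx
    have hx' : x ∈ Hs (idx x + 1) := ⟨idx x, Nat.lt_succ_self _, hidx x⟩
    rcases le_total m (idx x + 1) with hm | hm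
    · obtain ⟨d, hd⟩ := Nat.exists_eq_add_of_le hm
      have := hseq' m d x hx
      rw [← hd] at this
      exact this
    · obtain ⟨d, hd⟩ := Nat.exists_eq_add_of_le hm
      have := hseq' (idx x + 1) d x hx'
      rw [← hd] at this
      exact this.symm
  refine ⟨b0, g, ?_, ?_, ?_⟩
  · refine hN.2.2 g (fun F hF => ?_)
    obtain ⟨m, hm⟩ := hHcof F hF
    exact ⟨(seq m).1, (seq m).2.1, fun x hx => (hg m x (hm hx)).symm⟩
  · intro i a _
    obtain ⟨m, hm⟩ := hHcof (Set.range a) (Set.finite_range a)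
    have h1 : g ∘ a = (seq m).1 ∘ a := funext fun j => hg m _ (hm ⟨j, rfl⟩)
    rw [h1]
    exact (seq m).2.2.1 i a (fun j => hm ⟨j, rfl⟩)
  · obtain ⟨m, hm⟩ := hHcof (Set.range c) (Set.finite_range c)
    obtain ⟨γ, hγ⟩ := (seq m).2.2.2
    exact ⟨γ, fun j => (hg m _ (hm ⟨j, rfl⟩)).trans (hγ j)⟩

end Canonical

/-! ### The abstract finiteness argument -/

section Abstract

lemma closed_gen {D : Type} (A : Set (D → D)) : IsClosedTransMonoid (ClosedMonoidGenBy A) := by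
  refine ⟨?_, ?_, ?_⟩
  · rintro S ⟨hS, _⟩
    exact hS.1
  · intro g h hg hh S hS
    exact hS.1.2.1 g h (hg S hS) (hh S hS)
  · intro g hg S hS
    refine hS.1.2.2 g (fun F hF => ?_)
    obtain ⟨h, hh, hx⟩ := hg F hF
    exact ⟨h, hh S hS, hx⟩

lemma abstract_finite {D K : Type} [Finite K] (E : Set (D → D)) (Real : K → (D → D) → Prop)
    (h1 : ∀ N, IsClosedTransMonoid N → E ⊂ N → ∃ κ, ∃ g ∈ N, Real κ g)
    (h2 : ∀ κ g g' N, IsClosedTransMonoid N → E ⊆ N → Real κ g → Real κ g' → g ∈ N → g' ∈ N)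
    (h3 : ∀ κ g, Real κ g → g ∉ E) :
    {N : Set (D → D) | IsClosedTransMonoid N ∧ MinimalMonoidAbove E N}.Finite ∧
      ∀ R : Set (D → D), IsClosedTransMonoid R → E ⊂ R →
        ∃ N : Set (D → D), IsClosedTransMonoid N ∧ MinimalMonoidAbove E N ∧ N ⊆ R := by
  classical
  let T : K → Set (D → D) := fun κ => ClosedMonoidGenBy (E ∪ {g | Real κ g})
  have hTc : ∀ κ, IsClosedTransMonoid (T κ) := fun κ => closed_gen _
  have hTE : ∀ κ, (∃ g, Real κ g) → E ⊂ T κ := by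
    rintro κ ⟨g, hg⟩
    refine ⟨fun x hx S hS => hS.2 (Or.inl hx), fun hsub => h3 κ g hg (hsub ?_)⟩
    exact fun S hS => hS.2 (Or.inr hg)
  have hbelow : ∀ N, IsClosedTransMonoid N → E ⊂ N → ∃ κ, (∃ g, Real κ g) ∧ T κ ⊆ N := by
    intro N hN hEN
    obtain ⟨κ, g, hgN, hg⟩ := h1 N hN hEN
    refine ⟨κ, ⟨g, hg⟩, Set.sInter_subset_of_mem ⟨hN, ?_⟩⟩
    exact Set.union_subset hEN.1 (fun g' hg' => h2 κ g g' N hN hEN.1 hg hg' hgN)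
  constructor
  · refine (Set.finite_range T).subset ?_
    rintro N ⟨hN, hEN, hmin⟩
    obtain ⟨κ, hκ, hκN⟩ := hbelow N hN hEN
    exact ⟨κ, hmin _ (hTc κ) (hTE κ hκ) hκN⟩
  · intro R hR hER
    obtain ⟨κ, hκ, hκR⟩ := hbelow R hR hER
    let A : Set (Set (D → D)) := {N | (∃ κ', (∃ g, Real κ' g) ∧ T κ' = N) ∧ N ⊆ R}
    have hA : A.Finite := by
      refine (Set.finite_range T).subset ?_
      rintro N ⟨⟨κ', _, h⟩, _⟩
      exact ⟨κ', h⟩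
    obtain ⟨N, hNmin⟩ := hA.exists_minimal ⟨T κ, ⟨κ, hκ, rfl⟩, hκR⟩
    obtain ⟨⟨⟨κ', hκ', rfl⟩, hNR⟩, hmin⟩ := hNmin
    refine ⟨T κ', hTc κ', ⟨hTE κ' hκ', ?_⟩, hNR⟩
    intro R' hR' hER' hR'N
    obtain ⟨κ'', hκ'', hκR'⟩ := hbelow R' hR' hER'
    have := hmin (y := T κ'') ⟨⟨κ'', hκ'', rfl⟩, (hκR'.trans hR'N).trans hNR⟩
      (hκR'.trans hR'N)
    exact Set.Subset.antisymm hR'N (Set.Subset.trans this hκR')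

end Abstract

section Main

variable {L L' : Language} {M : Type} [L.Structure M] [L'.Structure M]

lemma reduct_aut (hred : IsReduct L L' M) (α : M ≃[L] M) {n : ℕ} (r : L'.Relations n)
    (x : Fin n → M) : Structure.RelMap r (α ∘ x) ↔ Structure.RelMap r x := by
  obtain ⟨φ, hφ⟩ := hred n r
  rw [hφ, hφ]
  exact StrongHomClass.realize_formula α φ

/-- The codes of canonical functions violating some relation. -/
abbrev Code (L L' : Language) :=
  Σ r : (Σ k, L'.Relations k), Atp L (Fin r.1) × Beh L r.1

/-- `g` realises a code. -/
def Realises (κ : Code L L') (g : M → M) : Prop :=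
  ∃ c : Fin κ.1.1 → M, atp L c = κ.2.1 ∧ HasBeh c κ.2.2 g Set.univ ∧
    Structure.RelMap κ.1.2 c ∧ ¬ Structure.RelMap κ.1.2 (g ∘ c)

end Main

end Aux
end PaperDef

namespace PaperDef
/-- **Proposition 9 of the paper.**  Let `Θ` (an `L'`-structure on `M`) with finite relational
signature be a reduct of a countably infinite ordered homogeneous Ramsey structure `Δ`
(an `L`-structure on `M`) with finite relational signature.  Then there are only finitely many
closed transformation monoids minimal above `End(Θ)`, and every closed transformation monoid
properly containing `End(Θ)` contains a minimal one. -/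
theorem finitely_many_minimal_monoids
    (L L' : Language) (M : Type) [L.Structure M] [L'.Structure M] [Countable M] [Infinite M]
    (hLrel : ∀ i, IsEmpty (L.Functions i)) (hLfin : Finite (Σ i, L.Relations i))
    (hTrel : ∀ i, IsEmpty (L'.Functions i)) (hTfin : Finite (Σ i, L'.Relations i))
    (hord : Ordered L M) (hhom : L.IsUltrahomogeneous M) (hram : RamseyClass (L.age M))
    (hred : IsReduct L L' M) :
    {N : Set (M → M) | IsClosedTransMonoid N ∧ MinimalMonoidAbove (EndSet L' M) N}.Finite ∧
      ∀ R : Set (M → M), IsClosedTransMonoid R → EndSet L' M ⊂ R →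
        ∃ N : Set (M → M), IsClosedTransMonoid N ∧ MinimalMonoidAbove (EndSet L' M) N ∧
          N ⊆ R := by
  have hfin : Finite (Aux.Code L L') := inferInstance
  -- codes live in a possibly larger universe, so we transport them to some `Fin m`
  obtain ⟨m, ⟨ε⟩⟩ := Finite.exists_equiv_fin (Aux.Code L L')
  have hAutE : ∀ α : M ≃[L] M, (α : M → M) ∈ EndSet L' M :=
    fun α n r x hx => (Aux.reduct_aut hred α r x).2 hx
  refine Aux.abstract_finite (K := Fin m) (EndSet L' M)
    (fun κ g => Aux.Realises (ε.symm κ) g) ?_ ?_ ?_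
  · intro N hN hEN
    obtain ⟨f, hfN, hfE⟩ := Set.exists_of_ssubset hEN
    have hviol : ∃ (n : ℕ) (r : L'.Relations n) (c : Fin n → M),
        Structure.RelMap r c ∧ ¬ Structure.RelMap r (f ∘ c) := by
      by_contra hcon
      push Not at hcon
      exact hfE (fun n r x hx => hcon n r x hx)
    obtain ⟨n, r, c, hc, hfc⟩ := hviol
    obtain ⟨b, g, hgN, hgb, γ, hγ⟩ := Aux.exists_global hLrel hLfin hord hhom hram hN
      (fun α => hEN.1 (hAutE α)) c hfN
    refine ⟨ε ⟨⟨n, r⟩, Aux.atp L c, b⟩, g, hgN, ?_⟩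
    rw [Equiv.symm_apply_apply]
    refine ⟨c, rfl, hgb, hc, fun hgc => hfc ?_⟩
    have h1 : g ∘ c = γ ∘ (f ∘ c) := funext hγ
    rw [h1] at hgc
    exact (Aux.reduct_aut hred γ r _).1 hgc
  · rintro κ g g' N hN hEN ⟨c, hc, hgb, -⟩ ⟨c', hc', hgb', -⟩ hgN
    obtain ⟨α, hα⟩ := Aux.exists_aut hLrel hhom (hc'.trans hc.symm)
    refine hN.2.2 g' (fun F hF => ?_)
    have : Finite F := hF.to_subtype
    have hty : Aux.atp L (Sum.elim c (α ∘ fun x : F => x.1)) =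
        Aux.atp L (Sum.elim c' (fun x : F => x.1)) := by
      have h1 : Sum.elim c (α ∘ fun x : F => x.1) = α ∘ Sum.elim c' (fun x : F => x.1) := by
        rw [Aux.sum_elim_comp]
        congr 1
        exact (funext hα).symm
      rw [h1, Aux.atp_aut]
    obtain ⟨β, hβ⟩ := Aux.exists_aut hLrel hhom
      (Aux.beh_atp hgb hgb' (fun _ => Set.mem_univ _) (fun _ => Set.mem_univ _) hty)
    refine ⟨β ∘ (g ∘ α), hN.2.1 _ _ (hEN (hAutE β)) (hN.2.1 _ _ hgN (hEN (hAutE α))), ?_⟩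
    intro x hx
    exact hβ ⟨x, hx⟩
  · rintro κ g ⟨c, -, -, hc, hgc⟩ hgE
    exact hgc (hgE _ _ c hc)

end PaperDef
end

section
/- Let Δ be a countably infinite ordered homogeneous Ramsey structure with finite relational signature, let f be an m-ary operation on the domain of Δ, and let c₁ = (c₁¹,…,c₁^{n₁}), …, cₘ = (cₘ¹,…,cₘ^{nₘ}) be finite tuples of elements of Δ. Then f generates over Δ an m-ary operation g that is canonical as a function from (Δ,c₁)×⋯×(Δ,cₘ) to Δ and agrees with f on all m-tuples of the form (c₁^{j₁}, …, cₘ^{jₘ}) with jᵢ ≤ nᵢ. -/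
open FirstOrder FirstOrder.Language

namespace PaperDef
namespace Aux

open FirstOrder.Language.Structure

universe u v

variable {L : FirstOrder.Language.{u, v}} {M : Type} [L.Structure M]

/-- In a relational language every set is a substructure. -/
def relSub (hrel : ∀ i, IsEmpty (L.Functions i)) (s : Set M) : L.Substructure M where
  carrier := s
  fun_mem := fun {n} f => ((hrel n).false f).elim

theorem mem_relSub (hrel : ∀ i, IsEmpty (L.Functions i)) (s : Set M) (x : M) :
    x ∈ relSub hrel s ↔ x ∈ s := Iff.rfl

theorem funMap_of_rel (hrel : ∀ i, IsEmpty (L.Functions i)) {n : ℕ} (f : L.Functions n)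
    {p : Prop} : p := ((hrel n).false f).elim

theorem extend_tuple (hrel : ∀ i, IsEmpty (L.Functions i)) (hhom : L.IsUltrahomogeneous M)
    {ι : Type} [Finite ι] (a b : ι → M)
    (heq : ∀ i j, a i = a j ↔ b i = b j)
    (hr : ∀ (n : ℕ) (r : L.Relations n) (x : Fin n → ι),
      RelMap r (fun k => a (x k)) ↔ RelMap r (fun k => b (x k))) :
    ∃ g : M ≃[L] M, ∀ i, g (a i) = b i := by
  let S : L.Substructure M := relSub hrel (Set.range a)
  have hS : Finite S := (Set.finite_range a).to_subtype
  have ch : ∀ s : S, ∃ i, a i = s.1 := fun s => s.2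
  choose q hq using ch
  let e : S ↪[L] M :=
    { toFun := fun s => b (q s)
      inj' := by
        intro s t h
        have h1 := (heq (q s) (q t)).2 h
        rw [hq, hq] at h1
        exact Subtype.ext h1
      map_fun' := fun f _ => funMap_of_rel hrel f
      map_rel' := by
        intro n r x
        have h1 := hr n r (fun k => q (x k))
        simp only [hq] at h1
        exact h1.symm }
  obtain ⟨g, hg⟩ := hhom S Substructure.FG.of_finite e
  refine ⟨g, fun i => ?_⟩
  have h1 : e ⟨a i, i, rfl⟩ = g (a i) := by rw [hg]; rfl
  rw [← h1]
  exact (heq _ _).1 (hq ⟨a i, i, rfl⟩)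

/-- Embeddings of finite structures into `M` over another one extend to automorphisms. -/
theorem extend_emb (hrel : ∀ i, IsEmpty (L.Functions i)) (hhom : L.IsUltrahomogeneous M)
    (A : Set M) (hA : A.Finite) (e : relSub hrel A ↪[L] M) :
    ∃ g : M ≃[L] M, ∀ x (hx : x ∈ A), g x = e ⟨x, hx⟩ := by
  have hS : Finite (relSub hrel A) := hA.to_subtype
  obtain ⟨g, hg⟩ := hhom (relSub hrel A) Substructure.FG.of_finite e
  exact ⟨g, fun x hx => by rw [hg]; rfl⟩

theorem rigid_s15 (hord : Ordered L M) (A : Set M) (hA : A.Finite) (g h : M ≃[L] M)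
    (hgh : g '' A = h '' A) : ∀ x ∈ A, g x = h x := by
  classical
  obtain ⟨r, hr⟩ := hord
  let lo : LinearOrder M :=
    { le := fun a b => RelMap r ![a, b]
      le_refl := hr.refl
      le_trans := hr.trans
      le_antisymm := hr.antisymm
      le_total := hr.total
      toDecidableLE := Classical.decRel _ }
  have key : ∀ (g : M ≃[L] M) (x y : M), g x ≤ g y ↔ x ≤ y := by
    intro g x y
    have h1 := g.map_rel r ![x, y]
    have h2 : (g ∘ ![x, y]) = ![g x, g y] := by
      funext i; fin_cases i <;> rfl
    rw [h2] at h1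
    exact h1
  have hfA : Finite A := hA.to_subtype
  let B := g '' A
  let og : A ≃o B :=
    { toEquiv := Equiv.Set.image g A g.injective
      map_rel_iff' := by
        intro a b
        exact key g a b }
  let oh' : A ≃o (h '' A : Set M) :=
    { toEquiv := Equiv.Set.image h A h.injective
      map_rel_iff' := by
        intro a b
        exact key h a b }
  let oh : A ≃o B := oh'.trans (OrderIso.setCongr _ _ hgh.symm)
  have := Subsingleton.elim og oh
  intro x hx
  have h3 : (og ⟨x, hx⟩).1 = (oh ⟨x, hx⟩).1 := by rw [this]
  exact h3

/-- Combinatorial form of extreme amenability of a set (group) of automorphisms. -/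
def EA (G : Set (M ≃[L] M)) : Prop :=
  ∀ (κ : Type) [Finite κ] (A : Set M), A.Finite → ∀ χ : (M ≃[L] M) → κ,
    (∀ g h : M ≃[L] M, (∀ x ∈ A, g x = h x) → χ g = χ h) →
    ∀ Γ : Set (M ≃[L] M), Γ.Finite → Γ ⊆ G →
      ∃ α ∈ G, ∀ γ ∈ Γ, χ (α.comp γ) = χ α

theorem ea_univ (hrel : ∀ i, IsEmpty (L.Functions i)) (hord : Ordered L M)
    (hhom : L.IsUltrahomogeneous M) (hram : RamseyClass (L.age M)) :
    EA (Set.univ : Set (M ≃[L] M)) := by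
  classical
  intro κ _ A hA χ hχ Γ hΓ _
  obtain ⟨k, ⟨eκ⟩⟩ := Finite.exists_equiv_fin κ
  have hk : 1 ≤ k := by
    have := (eκ (χ (FirstOrder.Language.Equiv.refl L M))).pos
    omega
  let Γ' : Set (M ≃[L] M) := insert (FirstOrder.Language.Equiv.refl L M) Γ
  have hΓ' : Γ'.Finite := hΓ.insert _
  let B : Set M := ⋃ γ ∈ Γ', γ '' A
  have hB : B.Finite := hΓ'.biUnion (fun γ _ => hA.image _)
  let P : CategoryTheory.Bundled.{0} L.Structure := ⟨relSub hrel A, inferInstance⟩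
  let H : CategoryTheory.Bundled.{0} L.Structure := ⟨relSub hrel B, inferInstance⟩
  have hAf : Finite (relSub hrel A) := hA.to_subtype
  have hBf : Finite (relSub hrel B) := hB.to_subtype
  have hP : P ∈ L.age M := ⟨Structure.FG.of_finite, ⟨(relSub hrel A).subtype⟩⟩
  have hH : H ∈ L.age M := ⟨Structure.FG.of_finite, ⟨(relSub hrel B).subtype⟩⟩
  obtain ⟨S, ⟨hSfg, ⟨j⟩⟩, hS⟩ := hram k hk H hH P hP
  -- automorphism associated with a copy
  have hg : ∀ Q : {Q : L.Substructure S // Nonempty (P ≃[L] Q)},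
      ∃ g : M ≃[L] M, g '' A = j '' (Q.1 : Set S) := by
    rintro ⟨Q, ⟨φ⟩⟩
    let e : relSub hrel A ↪[L] M := j.comp (Q.subtype.comp φ.toEmbedding)
    obtain ⟨g, hg⟩ := extend_emb hrel hhom A hA e
    refine ⟨g, ?_⟩
    ext y
    constructor
    · rintro ⟨x, hx, rfl⟩
      rw [hg x hx]
      exact ⟨(φ ⟨x, hx⟩ : Q), (φ ⟨x, hx⟩ : Q).2, rfl⟩
    · rintro ⟨s, hs, rfl⟩
      obtain ⟨p, hp⟩ := φ.surjective ⟨s, hs⟩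
      refine ⟨p.1, p.2, ?_⟩
      rw [hg p.1 p.2]
      change j ((φ p : Q) : S) = j s
      rw [hp]
  choose G hG using hg
  obtain ⟨e, he⟩ := hS (fun Q => eκ (χ (G Q)))
  obtain ⟨α, hα⟩ := extend_emb hrel hhom B hB (j.comp e)
  refine ⟨α, trivial, ?_⟩
  have copy : ∀ γ ∈ Γ', ∃ Q : {Q : L.Substructure S // Nonempty (P ≃[L] Q)},
      (Q.1 : Set S) ⊆ Set.range e ∧ χ (G Q) = χ (α.comp γ) := by
    intro γ hγ
    have hmem : ∀ x ∈ A, γ x ∈ B := fun x hx =>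
      Set.mem_biUnion hγ ⟨x, hx, rfl⟩
    let i : P ↪[L] H :=
      { toFun := fun x => ⟨γ x.1, hmem x.1 x.2⟩
        inj' := by
          intro x y hxy
          have h1 : γ x.1 = γ y.1 := congrArg Subtype.val hxy
          exact Subtype.ext (γ.injective h1)
        map_fun' := fun f _ => funMap_of_rel hrel f
        map_rel' := by
          intro n r x
          exact γ.map_rel r (fun k => (x k).1) }
    let Q : {Q : L.Substructure S // Nonempty (P ≃[L] Q)} :=
      ⟨(e.comp i).toHom.range, ⟨(e.comp i).equivRange⟩⟩
    have hQ : ∀ s, s ∈ (Q.1 : Set S) ↔ ∃ x, (e.comp i) x = s := by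
      intro s
      exact Iff.rfl
    refine ⟨Q, ?_, ?_⟩
    · intro s hs
      obtain ⟨x, rfl⟩ := (hQ s).1 hs
      exact ⟨i x, rfl⟩
    · refine hχ _ _ (rigid_s15 hord A hA _ _ ?_)
      rw [hG]
      ext y
      constructor
      · rintro ⟨s, hs, rfl⟩
        obtain ⟨x, rfl⟩ := (hQ s).1 hs
        refine ⟨x.1, x.2, ?_⟩
        exact hα _ (hmem x.1 x.2)
      · rintro ⟨x, hx, rfl⟩
        refine ⟨e (i ⟨x, hx⟩), (hQ _).2 ⟨⟨x, hx⟩, rfl⟩, ?_⟩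
        exact (hα _ (hmem x hx)).symm
  intro γ hγ
  obtain ⟨Q₁, h1, h1'⟩ := copy γ (Set.mem_insert_of_mem _ hγ)
  obtain ⟨Q₂, h2, h2'⟩ := copy _ (Set.mem_insert _ _)
  have h3 := eκ.injective (he Q₁ Q₂ h1 h2)
  rw [h1', h2'] at h3
  rw [h3]
  exact hχ _ _ (fun x _ => rfl)

/-- Pointwise stabiliser of a tuple. -/
def Stab {n : ℕ} (c : Fin n → M) : Set (M ≃[L] M) := {g | ∀ i, g (c i) = c i}

theorem ea_stab (h : EA (Set.univ : Set (M ≃[L] M))) {n : ℕ} (c : Fin n → M) :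
    EA (Stab (L := L) c) := by
  classical
  intro κ _ A hA χ hχ Γ hΓ hΓs
  have hβ : ∀ c' : Fin n → M, ∃ β : M ≃[L] M,
      (∃ g : M ≃[L] M, ∀ i, g (c' i) = c i) → ∀ i, β (c' i) = c i := by
    intro c'
    by_cases hc : ∃ g : M ≃[L] M, ∀ i, g (c' i) = c i
    · obtain ⟨g, hg⟩ := hc
      exact ⟨g, fun _ => hg⟩
    · exact ⟨FirstOrder.Language.Equiv.refl L M, fun h => (hc h).elim⟩
  choose β hβ using hβ
  obtain ⟨α, -, hα⟩ := h κ (A ∪ Set.range c) (hA.union (Set.finite_range c))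
    (fun g => χ ((β (fun i => g (c i))).comp g)) (by
      intro g g' hgg
      have h1 : (fun i => g (c i)) = (fun i => g' (c i)) :=
        funext fun i => hgg _ (Or.inr ⟨i, rfl⟩)
      simp only [h1]
      refine hχ _ _ fun x hx => ?_
      simp only [FirstOrder.Language.Equiv.comp_apply]
      rw [hgg x (Or.inl hx)]) Γ hΓ (Set.subset_univ _)
  refine ⟨(β (fun i => α (c i))).comp α, ?_, ?_⟩
  · intro i
    exact hβ (fun i => α (c i)) ⟨α.symm, fun i => α.symm_apply_apply _⟩ i
  · intro γ hγ
    have h1 := hα γ hγ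
    have h2 : (fun i => (α.comp γ) (c i)) = (fun i => α (c i)) :=
      funext fun i => by
        rw [FirstOrder.Language.Equiv.comp_apply, hΓs hγ i]
    simp only [h2] at h1
    rw [← h1]
    exact hχ _ _ fun x _ => rfl

theorem ea_fin {G : Set (M ≃[L] M)} (h : EA G) (κ : Type) [Finite κ] (A : Set M) (hA : A.Finite)
    (Γ : Set (M ≃[L] M)) (hΓ : Γ.Finite) (hΓG : Γ ⊆ G) :
    ∃ E : Set (M ≃[L] M), E.Finite ∧ E ⊆ G ∧ ∀ χ : (M ≃[L] M) → κ,
      (∀ g h : M ≃[L] M, (∀ x ∈ A, g x = h x) → χ g = χ h) →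
      ∃ α ∈ E, ∀ γ ∈ Γ, χ (α.comp γ) = χ α := by
  let : TopologicalSpace κ := ⊥
  have : DiscreteTopology κ := ⟨rfl⟩
  let K : Set ((M ≃[L] M) → κ) :=
    ⋂ (g : M ≃[L] M) (g' : M ≃[L] M) (_ : ∀ x ∈ A, g x = g' x), {χ | χ g = χ g'}
  have hK : IsCompact K := by
    refine IsClosed.isCompact ?_
    refine isClosed_iInter fun g => isClosed_iInter fun g' => isClosed_iInter fun _ => ?_
    exact isClosed_eq (continuous_apply g) (continuous_apply g')
  let U : (M ≃[L] M) → Set ((M ≃[L] M) → κ) := fun α =>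
    ⋂ γ ∈ Γ, {χ | χ (α.comp γ) = χ α}
  obtain ⟨E, hEG, hE, hcov⟩ := hK.elim_finite_subcover_image (b := G) (c := U) (by
      intro α _
      refine hΓ.isOpen_biInter fun γ _ => ?_
      have hc : Continuous (fun χ : (M ≃[L] M) → κ => (χ (α.comp γ), χ α)) :=
        (continuous_apply _).prodMk (continuous_apply _)
      exact (isOpen_discrete {p : κ × κ | p.1 = p.2}).preimage hc) (by
      intro χ hχ
      simp only [K, Set.mem_iInter, Set.mem_ofPred_eq] at hχ
      obtain ⟨α, hα, h2⟩ := h κ A hA χ hχ Γ hΓ hΓG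
      refine Set.mem_biUnion hα ?_
      simp only [U, Set.mem_iInter, Set.mem_ofPred_eq]
      exact h2)
  refine ⟨E, hE, hEG, fun χ hχ => ?_⟩
  have h1 : χ ∈ K := by
    simp only [K, Set.mem_iInter, Set.mem_ofPred_eq]
    exact hχ
  have h2 := hcov h1
  simp only [U, Set.mem_iUnion, Set.mem_iInter, Set.mem_ofPred_eq] at h2
  obtain ⟨α, hα, h3⟩ := h2
  exact ⟨α, hα, h3⟩

theorem ea_prod {m : ℕ} (G : Fin m → Set (M ≃[L] M)) (h : ∀ i, EA (G i))
    (T : Finset (Fin m)) : ∀ (κ : Type) [Finite κ] (A : Set M), A.Finite →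
    ∀ χ : (Fin m → M ≃[L] M) → κ,
    (∀ g h : Fin m → M ≃[L] M, (∀ i, ∀ x ∈ A, g i x = h i x) → χ g = χ h) →
    ∀ Γ : Set (Fin m → M ≃[L] M), Γ.Finite → (∀ γ ∈ Γ, ∀ i ∈ T, γ i ∈ G i) →
      (∀ γ ∈ Γ, ∀ i ∉ T, γ i = FirstOrder.Language.Equiv.refl L M) →
      ∃ α : Fin m → M ≃[L] M, (∀ i ∈ T, α i ∈ G i) ∧
        ∀ γ ∈ Γ, χ (fun i => (α i).comp (γ i)) = χ α := by
  classical
  induction T using Finset.induction_on with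
  | empty =>
    intro κ _ A hA χ hχ Γ hΓ _ h1
    refine ⟨fun _ => FirstOrder.Language.Equiv.refl L M, by simp, fun γ hγ => ?_⟩
    refine hχ _ _ fun i x _ => ?_
    rw [h1 γ hγ i (by simp)]
    rfl
  | insert i T hi ih =>
    intro κ _ A hA χ hχ Γ hΓ hG h1
    let Γi : Set (M ≃[L] M) := (fun γ => γ i) '' Γ
    have hΓi : Γi.Finite := hΓ.image _
    obtain ⟨E, hE, hEG, hEχ⟩ := ea_fin (h i) κ A hA Γi hΓi (by
      rintro _ ⟨γ, hγ, rfl⟩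
      exact hG γ hγ i (Finset.mem_insert_self _ _))
    let E' : Set (M ≃[L] M) := E ∪ Set.image2 (fun a b => a.comp b) E Γi
    have hE' : E'.Finite := hE.union (hE.image2 _ hΓi)
    have : Finite E' := hE'.to_subtype
    obtain ⟨α', hα'G, hα'⟩ := ih (E' → κ) A hA
      (fun g e => χ (Function.update g i e.1)) (by
        intro g g' hgg
        funext e
        refine hχ _ _ fun k x hx => ?_
        by_cases hk : k = i
        · subst hk; simp
        · simp [hk, hgg k x hx])
      ((fun γ => Function.update γ i (FirstOrder.Language.Equiv.refl L M)) '' Γ)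
      (hΓ.image _) (by
        rintro _ ⟨γ, hγ, rfl⟩ k hk
        have hki : k ≠ i := fun hh => hi (hh ▸ hk)
        simp only [Function.update_of_ne hki]
        exact hG γ hγ k (Finset.mem_insert_of_mem hk)) (by
        rintro _ ⟨γ, hγ, rfl⟩ k hk
        by_cases hki : k = i
        · subst hki; simp
        · simp only [Function.update_of_ne hki]
          exact h1 γ hγ k (by simp [hki, hk]))
    obtain ⟨a, haE, ha⟩ := hEχ (fun a => χ (Function.update α' i a)) (by
      intro g g' hgg
      refine hχ _ _ fun k x hx => ?_
      by_cases hk : k = i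
      · subst hk; simpa using hgg x hx
      · simp [hk])
    refine ⟨Function.update α' i a, ?_, ?_⟩
    · intro k hk
      by_cases hki : k = i
      · subst hki; simpa using hEG haE
      · simp only [Function.update_of_ne hki]
        exact hα'G k ((Finset.mem_insert.1 hk).resolve_left hki)
    · intro γ hγ
      have h2 := ha (γ i) ⟨γ, hγ, rfl⟩
      have h3 := congrFun (hα' _ ⟨γ, hγ, rfl⟩)
        ⟨a.comp (γ i), Or.inr ⟨a, haE, γ i, ⟨γ, hγ, rfl⟩, rfl⟩⟩
      rw [← h2]
      refine Eq.trans ?_ h3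
      refine hχ _ _ fun k x _ => ?_
      by_cases hk : k = i
      · subst hk; simp
      · simp [hk]

theorem _root_.PaperDef.SameOrbit.refl' {n : ℕ} (a : Fin n → M) : SameOrbit L M a a :=
  ⟨FirstOrder.Language.Equiv.refl L M, fun _ => rfl⟩

theorem _root_.PaperDef.SameOrbit.symm' {n : ℕ} {a b : Fin n → M} (h : SameOrbit L M a b) :
    SameOrbit L M b a := by
  obtain ⟨α, hα⟩ := h
  exact ⟨α.symm, fun i => by rw [← hα i, α.symm_apply_apply]⟩

theorem _root_.PaperDef.SameOrbit.trans' {n : ℕ} {a b d : Fin n → M} (h : SameOrbit L M a b)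
    (h' : SameOrbit L M b d) : SameOrbit L M a d := by
  obtain ⟨α, hα⟩ := h
  obtain ⟨β, hβ⟩ := h'
  exact ⟨β.comp α, fun i => by
    rw [FirstOrder.Language.Equiv.comp_apply, hα i, hβ i]⟩

variable (L M) in
/-- The orbit equivalence relation on `n`-tuples. -/
def orb (n : ℕ) : Setoid (Fin n → M) where
  r := SameOrbit L M
  iseqv := ⟨SameOrbit.refl', SameOrbit.symm', SameOrbit.trans'⟩

theorem finite_orb (hrel : ∀ i, IsEmpty (L.Functions i)) (hfin : Finite (Σ i, L.Relations i))
    (hhom : L.IsUltrahomogeneous M) (n : ℕ) : Finite (Quotient (orb L M n)) := by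
  let D := (Fin n → Fin n → Prop) × ((p : Σ i, L.Relations i) → (Fin p.1 → Fin n) → Prop)
  let d : (Fin n → M) → D := fun a =>
    (fun i j => a i = a j, fun p x => RelMap p.2 (fun k => a (x k)))
  have hD : Finite D := inferInstance
  have hd : ∀ a b, d a = d b → SameOrbit L M a b := by
    intro a b hab
    refine extend_tuple hrel hhom a b ?_ ?_
    · intro i j
      exact iff_of_eq (congrFun (congrFun (congrArg Prod.fst hab) i) j)
    · intro k r x
      exact iff_of_eq (congrFun (congrFun (congrArg Prod.snd hab) ⟨k, r⟩) x)
  refine Finite.of_injective (fun q : Quotient (orb L M n) => d q.out) ?_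
  intro p q hpq
  have := hd _ _ hpq
  rw [← Quotient.out_eq p, ← Quotient.out_eq q]
  exact Quotient.sound this

/-- A test for canonicity. -/
structure Test (L : FirstOrder.Language.{u, v}) (M : Type) [L.Structure M] {m : ℕ}
    {N : Fin m → ℕ} (c : ∀ i, Fin (N i) → M) where
  n : ℕ
  a : Fin n → Fin m → M
  b : Fin n → Fin m → M
  γ : Fin m → M ≃[L] M
  hγ : ∀ i, γ i ∈ Stab (L := L) (c i)
  hab : ∀ k i, γ i (a k i) = b k i

theorem finite_step (hrel : ∀ i, IsEmpty (L.Functions i)) (hfin : Finite (Σ i, L.Relations i))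
    (hord : Ordered L M) (hhom : L.IsUltrahomogeneous M) (hram : RamseyClass (L.age M))
    {m : ℕ} (f : (Fin m → M) → M) {N : Fin m → ℕ} (c : ∀ i, Fin (N i) → M)
    (F : Finset (Test L M c)) :
    ∃ α : Fin m → M ≃[L] M, (∀ i, α i ∈ Stab (L := L) (c i)) ∧
      ∀ t ∈ F, SameOrbit L M (fun k => f (fun i => α i (t.a k i)))
        (fun k => f (fun i => α i (t.b k i))) := by
  have hq := finite_orb (M := M) hrel hfin hhom
  let A : Set M := ⋃ t ∈ F, Set.range (fun p : Fin t.n × Fin m => t.a p.1 p.2)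
  have hA : A.Finite := F.finite_toSet.biUnion fun t _ => Set.finite_range _
  let χ : (Fin m → M ≃[L] M) → (∀ t : F, Quotient (orb L M t.1.n)) := fun h t =>
    Quotient.mk (orb L M t.1.n) (fun k => f (fun i => h i (t.1.a k i)))
  obtain ⟨α, hα, h⟩ := ea_prod (fun i => Stab (L := L) (c i))
    (fun i => ea_stab (ea_univ hrel hord hhom hram) (c i)) Finset.univ
    (∀ t : F, Quotient (orb L M t.1.n)) A hA χ (by
      intro g h hgh
      funext t
      simp only [χ]
      have : ∀ k i, g i (t.1.a k i) = h i (t.1.a k i) := fun k i =>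
        hgh i _ (Set.mem_biUnion t.2 ⟨(k, i), rfl⟩)
      simp only [this])
    ((fun t : Test L M c => t.γ) '' (F : Set (Test L M c))) (F.finite_toSet.image _)
    (by rintro _ ⟨t, _, rfl⟩ i _; exact t.hγ i)
    (by intro _ _ i hi; exact (hi (Finset.mem_univ i)).elim)
  refine ⟨α, fun i => hα i (Finset.mem_univ i), fun t ht => ?_⟩
  have h1 := congrFun (h t.γ ⟨t, ht, rfl⟩) ⟨t, ht⟩
  have h2 : SameOrbit L M (fun k => f (fun i => ((α i).comp (t.γ i)) (t.a k i)))
    (fun k => f (fun i => α i (t.a k i))) := Quotient.exact (s := orb L M t.n) h1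
  simp only [FirstOrder.Language.Equiv.comp_apply, t.hab] at h2
  exact h2.symm'

theorem canon_main [Countable M] [Nonempty M]
    (hrel : ∀ i, IsEmpty (L.Functions i)) (hfin : Finite (Σ i, L.Relations i))
    (hord : Ordered L M) (hhom : L.IsUltrahomogeneous M) (hram : RamseyClass (L.age M))
    {m : ℕ} (f : (Fin m → M) → M) {N : Fin m → ℕ} (c : ∀ i, Fin (N i) → M) :
    ∃ g : (Fin m → M) → M,
      (∀ F : Set (Fin m → M), F.Finite → ∃ (β : M ≃[L] M) (α : Fin m → M ≃[L] M),
        (∀ i, α i ∈ Stab (L := L) (c i)) ∧ ∀ x ∈ F, g x = β (f (fun i => α i (x i)))) ∧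
      ∀ t : Test L M c, SameOrbit L M (fun k => g (t.a k)) (fun k => g (t.b k)) := by
  classical
  choose α hαS hα using finite_step hrel hfin hord hhom hram f c
  let U : Ultrafilter (Finset (Test L M c)) := Ultrafilter.of Filter.atTop
  have hU : (U : Filter (Finset (Test L M c))) ≤ Filter.atTop := Ultrafilter.of_le _
  obtain ⟨x, hx⟩ := exists_surjective_nat (Fin m → M)
  let w : Finset (Test L M c) → (Fin m → M) → M := fun F y => f (fun i => α F i (y i))
  -- typical index
  have typ : ∀ n : ℕ, ∃ F₀, ∀ᶠ F in (U : Filter (Finset (Test L M c))),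
      SameOrbit L M (fun k : Fin n => w F₀ (x k)) (fun k : Fin n => w F (x k)) := by
    intro n
    have := finite_orb (M := M) hrel hfin hhom n
    let o : Finset (Test L M c) → Quotient (orb L M n) := fun F =>
      Quotient.mk (orb L M n) (fun k : Fin n => w F (x k))
    have h1 : ∃ q, ∀ᶠ F in (U : Filter (Finset (Test L M c))), o F = q := by
      have h2 : ∀ᶠ F in (U : Filter (Finset (Test L M c))), ∃ q, o F = q :=
        Filter.Eventually.of_forall fun F => ⟨_, rfl⟩
      exact Ultrafilter.eventually_exists_iff.1 h2
    obtain ⟨q, hq⟩ := h1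
    obtain ⟨F₀, hF₀⟩ := hq.exists
    refine ⟨F₀, hq.mono fun F hF => ?_⟩
    exact Quotient.exact (s := orb L M n) (hF₀.trans hF.symm)
  choose Φ hΦ using typ
  have step : ∀ n : ℕ, ∃ δ : M ≃[L] M, ∀ k < n, δ (w (Φ (n + 1)) (x k)) = w (Φ n) (x k) := by
    intro n
    obtain ⟨F, h1, h2⟩ := ((hΦ n).and (hΦ (n + 1))).exists
    obtain ⟨β₁, hβ₁⟩ := h1.symm'
    obtain ⟨β₂, hβ₂⟩ := h2
    refine ⟨β₁.comp β₂, fun k hk => ?_⟩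
    have h3 := hβ₁ ⟨k, hk⟩
    have h4 := hβ₂ ⟨k, by omega⟩
    simp only at h3 h4
    rw [FirstOrder.Language.Equiv.comp_apply, h4, h3]
  choose δ hδ using step
  let β : ℕ → M ≃[L] M := fun n =>
    Nat.rec (FirstOrder.Language.Equiv.refl L M) (fun n b => b.comp (δ n)) n
  have hβ : ∀ n, β (n + 1) = (β n).comp (δ n) := fun _ => rfl
  have stable : ∀ k n, k < n → β n (w (Φ n) (x k)) = β (k + 1) (w (Φ (k + 1)) (x k)) := by
    intro k n hkn
    induction n, hkn using Nat.le_induction with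
    | base => rfl
    | succ n hn ih =>
      rw [hβ, FirstOrder.Language.Equiv.comp_apply, hδ n k hn, ih]
  choose idx hidx using hx
  let g : (Fin m → M) → M := fun y => β (idx y + 1) (w (Φ (idx y + 1)) (x (idx y)))
  have hg : ∀ y n, idx y < n → g y = β n (w (Φ n) y) := by
    intro y n hn
    have := stable (idx y) n hn
    rw [hidx] at this
    simp only [g, hidx]
    exact this.symm
  have bd : ∀ F : Set (Fin m → M), F.Finite → ∃ n, ∀ y ∈ F, idx y < n := by
    intro F hF
    obtain ⟨n, hn⟩ := (hF.image idx).bddAbove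
    exact ⟨n + 1, fun y hy => Nat.lt_succ_of_le (hn ⟨y, hy, rfl⟩)⟩
  refine ⟨g, ?_, ?_⟩
  · intro F hF
    obtain ⟨n, hn⟩ := bd F hF
    exact ⟨β n, α (Φ n), hαS _, fun y hy => hg y n (hn y hy)⟩
  · intro t
    obtain ⟨n, hn⟩ := bd (Set.range t.a ∪ Set.range t.b)
      ((Set.finite_range _).union (Set.finite_range _))
    have hmem : ∀ᶠ F in (U : Filter (Finset (Test L M c))), t ∈ F := by
      refine hU ?_
      filter_upwards [Filter.eventually_ge_atTop {t}] with F hF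
      exact hF (Finset.mem_singleton_self t)
    obtain ⟨F, h1, h2⟩ := ((hΦ n).and hmem).exists
    obtain ⟨ε, hε⟩ := h1
    have hy : ∀ y, idx y < n → ε (w (Φ n) y) = w F y := by
      intro y hy
      have := hε ⟨idx y, hy⟩
      simp only [hidx] at this
      exact this
    have ha : SameOrbit L M (fun k => g (t.a k)) (fun k => w F (t.a k)) := by
      refine ⟨ε.comp (β n).symm, fun k => ?_⟩
      change (ε.comp (β n).symm) (g (t.a k)) = w F (t.a k)
      have hk := hn (t.a k) (Or.inl ⟨k, rfl⟩)
      rw [FirstOrder.Language.Equiv.comp_apply, hg _ n hk,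
        FirstOrder.Language.Equiv.symm_apply_apply, hy _ hk]
    have hb : SameOrbit L M (fun k => g (t.b k)) (fun k => w F (t.b k)) := by
      refine ⟨ε.comp (β n).symm, fun k => ?_⟩
      change (ε.comp (β n).symm) (g (t.b k)) = w F (t.b k)
      have hk := hn (t.b k) (Or.inr ⟨k, rfl⟩)
      rw [FirstOrder.Language.Equiv.comp_apply, hg _ n hk,
        FirstOrder.Language.Equiv.symm_apply_apply, hy _ hk]
    exact (ha.trans' (hα F t h2)).trans' hb.symm'

theorem sameType_of_orbit {n : ℕ} {a b : Fin n → M} (h : SameOrbit L M a b) :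
    SameType L M a b := by
  obtain ⟨α, hα⟩ := h
  intro φ
  have h1 : b = α ∘ a := funext fun i => (hα i).symm
  rw [h1]
  exact (FirstOrder.Language.StrongHomClass.realize_formula α φ).symm

theorem orbit_of_sameType (hrel : ∀ i, IsEmpty (L.Functions i))
    (hhom : L.IsUltrahomogeneous M) {N : ℕ} (c : Fin N → M) {n : ℕ} (a b : Fin n → M)
    (h : @SameType (L[[Fin N]]) M (withConstantsStruct L c) n a b) :
    ∃ γ ∈ Stab (L := L) c, ∀ k, γ (a k) = b k := by
  have key : ∀ φ : L.Formula (Fin N ⊕ Fin n),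
      φ.Realize (Sum.elim c a) ↔ φ.Realize (Sum.elim c b) := by
    intro φ
    let _ : (constantsOn (Fin N)).Structure M := constantsOn.structure c
    have h1 := h (BoundedFormula.constantsVarsEquiv.symm φ)
    have h2 : ∀ v : Fin n → M, φ.Realize (Sum.elim c v) ↔
        Formula.Realize (BoundedFormula.constantsVarsEquiv.symm φ : L[[Fin N]].Formula (Fin n))
          v := by
      intro v
      have h3 := BoundedFormula.realize_constantsVarsEquiv (M := M)
        (φ := (BoundedFormula.constantsVarsEquiv.symm φ : L[[Fin N]].BoundedFormula (Fin n) 0))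
        (v := v) (xs := default)
      rw [Equiv.apply_symm_apply] at h3
      exact h3
    rw [h2 a, h2 b]
    exact h1
  obtain ⟨γ, hγ⟩ := extend_tuple hrel hhom (Sum.elim c a) (Sum.elim c b) (by
      intro i j
      have := key ((Term.var i).equal (Term.var j))
      simpa only [Formula.realize_equal, Term.realize_var] using this) (by
      intro k r x
      have := key (r.formula (fun i => Term.var (x i)))
      simpa only [Formula.realize_rel, Term.realize_var] using this)
  exact ⟨γ, fun i => hγ (Sum.inl i), fun k => hγ (Sum.inr k)⟩

end Aux
end PaperDef

namespace PaperDef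
/-- **Lemma 11 of the paper.**  Higher-arity canonisation: an `m`-ary operation on a countably
infinite ordered homogeneous Ramsey structure with finite relational signature generates an
`m`-ary operation which is canonical from `(Δ,c₁) × ⋯ × (Δ,cₘ)` to `Δ` and agrees with the
original operation on the given tuples of constants. -/
theorem generates_canonical_higher_arity_function_with_constants
    (L : Language) (M : Type) [L.Structure M] [Countable M] [Infinite M]
    (hrel : ∀ i, IsEmpty (L.Functions i)) (hfin : Finite (Σ i, L.Relations i))
    (hord : Ordered L M) (hhom : L.IsUltrahomogeneous M) (hram : RamseyClass (L.age M))
    (m : ℕ) (hm : 1 ≤ m) (f : (Fin m → M) → M)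
    (N : Fin m → ℕ) (c : ∀ i, Fin (N i) → M) :
    ∃ g : (Fin m → M) → M, GeneratesOverClone L M f g ∧
      (∀ j : ∀ i, Fin (N i), g (fun i => c i (j i)) = f (fun i => c i (j i))) ∧
      @CanonicalProd m (fun i => L[[Fin (N i)]]) (fun _ => M)
        (fun i => withConstantsStruct L (c i)) L M _ g := by
  obtain ⟨g, hg, hcan⟩ := Aux.canon_main hrel hfin hord hhom hram f c
  obtain ⟨β₀, α₀, hα₀, h₀⟩ := hg (Set.range fun (j : ∀ i, Fin (N i)) i => c i (j i))
    (Set.finite_range _)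
  refine ⟨fun x => β₀.symm (g x), ?_, ?_, ?_⟩
  · intro F hF
    obtain ⟨β, α, -, h⟩ := hg F hF
    refine ⟨fun x => β₀.symm (β (f (fun i => α i (x i)))), ?_, fun x hx => by
      simp only [h x hx]⟩
    exact CloneTerm.autoComp β₀.symm (CloneTerm.autoComp β
      (CloneTerm.baseComp _ fun j => CloneTerm.autoComp (α j) (CloneTerm.proj j)))
  · intro j
    have h1 := h₀ _ ⟨j, rfl⟩
    have h2 : (fun i => α₀ i (c i (j i))) = fun i => c i (j i) :=
      funext fun i => hα₀ i (j i)
    simp only [h2] at h1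
    simp only [h1, FirstOrder.Language.Equiv.symm_apply_apply]
  · intro n a b hab
    have h1 : ∀ i, ∃ γ ∈ Aux.Stab (L := L) (c i), ∀ k, γ (a k i) = b k i := fun i =>
      Aux.orbit_of_sameType hrel hhom (c i) (fun k => a k i) (fun k => b k i) (hab i)
    choose γ hγ hγab using h1
    obtain ⟨ε, hε⟩ := hcan ⟨n, a, b, γ, hγ, fun k i => hγab i k⟩
    refine Aux.sameType_of_orbit ⟨β₀.symm.comp (ε.comp β₀), fun k => ?_⟩
    have h2 := hε k
    simp only at h2
    rw [FirstOrder.Language.Equiv.comp_apply, FirstOrder.Language.Equiv.comp_apply,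
      FirstOrder.Language.Equiv.apply_symm_apply, h2]

end PaperDef
end

section
/- Let Θ be a structure with finite relational signature that is a reduct of a countably infinite ordered homogeneous Ramsey structure with finite relational signature. Then there are only finitely many closed clones that are minimal above Pol(Θ), and every closed clone properly containing Pol(Θ) contains one that is minimal above Pol(Θ). -/
open FirstOrder FirstOrder.Language

namespace PaperDef

section Aux

variable {L : Language} {M : Type} [L.Structure M]

/-- The automorphism group as a group of permutations (relational language). -/
def AutG (L : Language) (M : Type) [L.Structure M] : Subgroup (Equiv.Perm M) where
  carrier := {g | ∀ (n : ℕ) (r : L.Relations n) (x : Fin n → M),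
    Structure.RelMap r (fun i => g (x i)) ↔ Structure.RelMap r x}
  mul_mem' := by
    intro a b ha hb n r x
    exact (ha n r (fun i => b (x i))).trans (hb n r x)
  one_mem' := fun n r x => Iff.rfl
  inv_mem' := by
    intro a ha n r x
    have := ha n r (fun i => a⁻¹ (x i))
    simpa using this.symm

theorem mem_AutG {g : Equiv.Perm M} : g ∈ AutG L M ↔ ∀ (n : ℕ) (r : L.Relations n) (x : Fin n → M),
    Structure.RelMap r (fun i => g (x i)) ↔ Structure.RelMap r x := Iff.rfl

/-- Turn an element of `AutG` into an `L`-equivalence. -/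
def autEquiv (hrel : ∀ i, IsEmpty (L.Functions i)) (g : Equiv.Perm M) (hg : g ∈ AutG L M) :
    M ≃[L] M where
  toEquiv := g
  map_fun' := fun {n} f _ => (hrel n).elim f
  map_rel' := fun {n} r x => hg n r x

theorem formula_inv (hrel : ∀ i, IsEmpty (L.Functions i)) {g : Equiv.Perm M} (hg : g ∈ AutG L M)
    {n : ℕ} (φ : L.Formula (Fin n)) (x : Fin n → M) :
    φ.Realize (fun i => g (x i)) ↔ φ.Realize x :=
  StrongHomClass.realize_formula (autEquiv hrel g hg) φ

/-- Two families agree on all atomic formulas. -/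
def SameAt (L : Language) {M : Type} [L.Structure M] {ι : Type*} (a b : ι → M) : Prop :=
  (∀ i j, a i = a j ↔ b i = b j) ∧
  ∀ (n : ℕ) (r : L.Relations n) (s : Fin n → ι),
    Structure.RelMap r (fun i => a (s i)) ↔ Structure.RelMap r (fun i => b (s i))

/-- The substructure on a set, in a relational language. -/
def subOf (hrel : ∀ i, IsEmpty (L.Functions i)) {N : Type*} [L.Structure N] (s : Set N) :
    L.Substructure N where
  carrier := s
  fun_mem := fun {n} f => (hrel n).elim f

theorem homog (hrel : ∀ i, IsEmpty (L.Functions i)) (hhom : L.IsUltrahomogeneous M)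
    {ι : Type*} [Finite ι] {a b : ι → M} (h : SameAt L a b) :
    ∃ g ∈ AutG L M, ∀ i, g (a i) = b i := by
  classical
  let S : L.Substructure M := subOf hrel (Set.range a)
  have hfin : Finite S := (Set.finite_range a).to_subtype
  have hch : ∀ x : S, ∃ i, a i = x := fun x => x.2
  choose c hc using hch
  let f : S ↪[L] M :=
    { toFun := fun x => b (c x)
      inj' := by
        intro x y hxy
        have := (h.1 (c x) (c y)).2 hxy
        rw [hc, hc] at this
        exact Subtype.ext this
      map_fun' := fun {n} f _ => (hrel n).elim f
      map_rel' := by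
        intro n r x
        have := h.2 n r (fun i => c (x i))
        simp only [hc] at this
        exact this.symm }
  obtain ⟨g, hg⟩ := hhom S Substructure.FG.of_finite f
  refine ⟨g.toEquiv, fun n r x => g.map_rel r x, fun i => ?_⟩
  have hi : a i ∈ S := ⟨i, rfl⟩
  have h1 : f ⟨a i, hi⟩ = g (a i) := by rw [hg]; rfl
  have h2 : f ⟨a i, hi⟩ = b (c ⟨a i, hi⟩) := rfl
  have h3 : b (c ⟨a i, hi⟩) = b i := (h.1 _ _).1 (hc ⟨a i, hi⟩)
  calc g.toEquiv (a i) = g (a i) := rfl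
    _ = b i := by rw [← h1, h2, h3]

theorem sameAt_of_aut {ι : Type*} {a b : ι → M} {g : Equiv.Perm M} (hg : g ∈ AutG L M)
    (h : ∀ i, g (a i) = b i) : SameAt L a b := by
  refine ⟨fun i j => ?_, fun n r s => ?_⟩
  · rw [← h, ← h]; exact g.injective.eq_iff.symm
  · simp only [← h]; exact (hg n r _).symm

theorem rigid_s17 (hord : Ordered L M) {g : Equiv.Perm M} (hg : g ∈ AutG L M) {F : Set M}
    (hF : F.Finite) (h : ∀ x ∈ F, g x ∈ F) : ∀ x ∈ F, g x = x := by
  obtain ⟨r, hr⟩ := hord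
  have hm : ∀ a b, Structure.RelMap r ![a, b] → Structure.RelMap r ![g a, g b] := by
    intro a b hab
    have := (hg 2 r ![a, b]).2 hab
    convert this using 1
    ext i; fin_cases i <;> rfl
  have hmn : ∀ n : ℕ, ∀ a b, Structure.RelMap r ![a, b] →
      Structure.RelMap r ![(g ^ n) a, (g ^ n) b] := by
    intro n
    induction n with
    | zero => intro a b hab; exact hab
    | succ n ih => intro a b hab; rw [pow_succ']; exact hm _ _ (ih a b hab)
  intro x hx
  have hpow : ∀ n : ℕ, (g ^ n) x ∈ F := by
    intro n
    induction n with
    | zero => exact hx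
    | succ n ih => rw [pow_succ']; exact h _ ih
  have hN : ∃ N : ℕ, (g ^ (N + 1)) x = x := by
    have : ¬ Function.Injective (fun n : ℕ => (⟨(g ^ n) x, hpow n⟩ : F)) := by
      intro hi
      have := hF.to_subtype
      exact not_injective_infinite_finite _ hi
    have hkey : ∀ m n : ℕ, m < n → (g ^ m) x = (g ^ n) x → ∃ N : ℕ, (g ^ (N + 1)) x = x := by
      intro m n hmn he
      obtain ⟨k, rfl⟩ := Nat.exists_eq_add_of_lt hmn
      refine ⟨k, ?_⟩
      rw [show m + k + 1 = m + (k + 1) by ring, pow_add] at he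
      exact ((g ^ m).injective he).symm
    rw [Function.not_injective_iff] at this
    obtain ⟨m, n, he, hne⟩ := this
    have he' : (g ^ m) x = (g ^ n) x := congrArg Subtype.val he
    rcases lt_or_gt_of_ne hne with h1 | h1
    · exact hkey _ _ h1 he'
    · exact hkey _ _ h1 he'.symm
  obtain ⟨N, hN⟩ := hN
  have trans' : ∀ a b c, Structure.RelMap r ![a, b] → Structure.RelMap r ![b, c] →
      Structure.RelMap r ![a, c] := fun a b c => hr.toIsPartialOrder.toIsPreorder.trans a b c
  have refl' : ∀ a, Structure.RelMap r ![a, a] := fun a => hr.toIsPartialOrder.toIsPreorder.refl a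
  have anti : ∀ a b, Structure.RelMap r ![a, b] → Structure.RelMap r ![b, a] → a = b :=
    fun a b => hr.toIsPartialOrder.toAntisymm.antisymm a b
  rcases hr.toTotal.total x (g x) with h1 | h1
  · have : ∀ n : ℕ, Structure.RelMap r ![g x, (g ^ (n + 1)) x] := by
      intro n
      induction n with
      | zero => simpa using refl' (g x)
      | succ n ih =>
        refine trans' _ _ _ ih ?_
        have := hmn (n + 1) _ _ h1
        rwa [← Equiv.Perm.mul_apply, ← pow_succ] at this
    have := this N
    rw [hN] at this
    exact anti _ _ this h1
  · have : ∀ n : ℕ, Structure.RelMap r ![(g ^ (n + 1)) x, g x] := by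
      intro n
      induction n with
      | zero => simpa using refl' (g x)
      | succ n ih =>
        refine trans' _ _ _ ?_ ih
        have := hmn (n + 1) _ _ h1
        rwa [← Equiv.Perm.mul_apply, ← pow_succ] at this
    have := this N
    rw [hN] at this
    exact anti _ _ h1 this

/-- Infinite form of the Ramsey property for a group of permutations. -/
def RP (G : Subgroup (Equiv.Perm M)) : Prop :=
  ∀ (κ : Type) [Finite κ] (χ : Equiv.Perm M → κ) (F : Set M), F.Finite →
    (∀ g ∈ G, ∀ u ∈ G, (∀ x ∈ F, u x = x) → χ (g * u) = χ g) →
    ∀ E : Set (Equiv.Perm M), E.Finite → E ⊆ G →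
      ∃ α ∈ G, ∀ e ∈ E, ∀ e' ∈ E, χ (α * e) = χ (α * e')

theorem rp_aut (hrel : ∀ i, IsEmpty (L.Functions i)) (hord : Ordered L M)
    (hhom : L.IsUltrahomogeneous M) (hram : RamseyClass (L.age M)) : RP (AutG L M) := by
  classical
  intro κ _ χ F hF hχ E hE hEG
  have _ : Fintype κ := Fintype.ofFinite κ
  have hF' := hF.to_subtype
  let P : L.Substructure M := subOf hrel F
  have hPfin : Finite P := hF.to_subtype
  let Hs : Set M := ⋃ e ∈ E, e '' F
  have hHs : Hs.Finite := hE.biUnion (fun e _ => hF.image e)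
  let H : L.Substructure M := subOf hrel Hs
  have hHfin : Finite H := hHs.to_subtype
  have hκ : 1 ≤ Fintype.card κ := Fintype.card_pos_iff.2 ⟨χ 1⟩
  obtain ⟨S, ⟨hSfg, ⟨ι⟩⟩, hS⟩ := hram (Fintype.card κ) hκ
    (CategoryTheory.Bundled.of H) ⟨Structure.FG.of_finite (M := H), ⟨H.subtype⟩⟩
    (CategoryTheory.Bundled.of P) ⟨Structure.FG.of_finite (M := P), ⟨P.subtype⟩⟩
  -- color of a set
  let col : Set M → κ := fun A =>
    if h : ∃ g ∈ AutG L M, g '' F = A then χ h.choose else χ 1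
  have hcol : ∀ g ∈ AutG L M, col (g '' F) = χ g := by
    intro g hg
    have h : ∃ g₁ ∈ AutG L M, g₁ '' F = g '' F := ⟨g, hg, rfl⟩
    have e1 : col (g '' F) = χ h.choose := dif_pos h
    rw [e1]
    obtain ⟨h1, h2⟩ := h.choose_spec
    set g' := h.choose
    have hu : g⁻¹ * g' ∈ AutG L M := mul_mem (inv_mem hg) h1
    have hfix : ∀ x ∈ F, (g⁻¹ * g') x = x := by
      apply rigid_s17 hord hu hF
      intro x hx
      have : g' x ∈ g '' F := by rw [← h2]; exact ⟨x, hx, rfl⟩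
      obtain ⟨y, hy, hyx⟩ := this
      rw [Equiv.Perm.mul_apply, ← hyx]
      simpa using hy
    have := hχ g hg _ hu hfix
    rwa [mul_inv_cancel_left] at this
  obtain ⟨e, he⟩ := hS (fun Q => Fintype.equivFin κ (col (ι '' (Q.1 : Set S))))
  -- extend to an automorphism
  have hα : ∃ α ∈ AutG L M, ∀ x : H, α (x : M) = ι (e x) := by
    apply homog hrel hhom
    refine ⟨fun i j => ?_, fun n r s => ?_⟩
    · rw [Subtype.coe_inj]
      exact ((ι.injective.eq_iff).trans (e.injective.eq_iff)).symm
    · have h1 : Structure.RelMap r (fun i => ((s i : H) : M)) ↔ Structure.RelMap r s := Iff.rfl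
      rw [h1]
      exact ((ι.map_rel r (fun i => e (s i))).trans (e.map_rel r s)).symm
  obtain ⟨α, hαG, hα⟩ := hα
  refine ⟨α, hαG, ?_⟩
  have key : ∀ d ∈ E, ∃ Q : {Q : L.Substructure S // Nonempty (P ≃[L] Q)},
      (Q.1 : Set S) ⊆ Set.range e ∧ ι '' (Q.1 : Set S) = (α * d) '' F := by
    intro d hd
    have hmem : ∀ x ∈ F, d x ∈ H := fun x hx => Set.mem_biUnion hd ⟨x, hx, rfl⟩
    let q : P → S := fun x => e ⟨d x, hmem x x.2⟩
    have hιq : ∀ x : P, ι (q x) = (α * d) x := by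
      intro x
      exact (hα ⟨d x, hmem x x.2⟩).symm
    have hq : Function.Injective q := by
      intro x y hxy
      have := congrArg ι hxy
      rw [hιq, hιq] at this
      exact Subtype.ext ((α * d).injective this)
    let Q : L.Substructure S := subOf hrel (Set.range q)
    refine ⟨⟨Q, ⟨?_⟩⟩, ?_, ?_⟩
    · exact
        { toEquiv := Equiv.ofInjective q hq
          map_fun' := fun {n} f _ => (hrel n).elim f
          map_rel' := by
            intro n r x
            have h1 := ι.map_rel r (fun i => q (x i))
            have h2 := mem_AutG.1 (mul_mem hαG (hEG hd)) n r (fun i => (x i : M))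
            have h3 : (fun i => ι (q (x i))) = fun i => (α * d) (x i : M) :=
              funext fun i => hιq _
            have h4 : (ι ∘ fun i => q (x i)) = fun i => ι (q (x i)) := rfl
            rw [h4, h3] at h1
            exact h1.symm.trans h2 }
    · rintro _ ⟨x, rfl⟩
      exact ⟨_, rfl⟩
    · ext y
      constructor
      · rintro ⟨_, ⟨x, rfl⟩, rfl⟩
        exact ⟨x, x.2, (hιq x).symm⟩
      · rintro ⟨x, hx, rfl⟩
        exact ⟨q ⟨x, hx⟩, ⟨_, rfl⟩, hιq ⟨x, hx⟩⟩
  intro d hd d' hd'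
  obtain ⟨Q, hQ1, hQ2⟩ := key d hd
  obtain ⟨Q', hQ1', hQ2'⟩ := key d' hd'
  have h := he Q Q' hQ1 hQ1'
  have h := (Fintype.equivFin κ).injective h
  rw [hQ2, hQ2', hcol _ (mul_mem hαG (hEG hd)), hcol _ (mul_mem hαG (hEG hd'))] at h
  exact h

/-- pointwise stabilizer -/
def fixSub (G : Subgroup (Equiv.Perm M)) (c : Set M) : Subgroup (Equiv.Perm M) where
  carrier := {g | g ∈ G ∧ ∀ x ∈ c, g x = x}
  mul_mem' := by
    rintro a b ⟨ha, ha'⟩ ⟨hb, hb'⟩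
    exact ⟨mul_mem ha hb, fun x hx => by rw [Equiv.Perm.mul_apply, hb' x hx, ha' x hx]⟩
  one_mem' := ⟨one_mem _, fun _ _ => rfl⟩
  inv_mem' := by
    rintro a ⟨ha, ha'⟩
    exact ⟨inv_mem ha, fun x hx => by rw [Equiv.Perm.inv_eq_iff_eq, ha' x hx]⟩

theorem rp_fix {G : Subgroup (Equiv.Perm M)} (h : RP G) {c : Set M} (hc : c.Finite) :
    RP (fixSub G c) := by
  intro κ _ χ F hF hχ E hE hEG
  let s : Equiv.Perm M → Equiv.Perm M := fun g => (QuotientGroup.mk (s := fixSub G c) g).out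
  have hs : ∀ g, (s g)⁻¹ * g ∈ fixSub G c := by
    intro g
    have : QuotientGroup.mk (s := fixSub G c) (s g) = QuotientGroup.mk g := Quotient.out_eq _
    exact QuotientGroup.eq.1 this
  have hs' : ∀ g, ∀ u ∈ fixSub G c, s (g * u) = s g := by
    intro g u hu
    have : QuotientGroup.mk (s := fixSub G c) (g * u) = QuotientGroup.mk g :=
      QuotientGroup.mk_mul_of_mem g hu
    simp only [s, this]
  obtain ⟨α, hα, hα'⟩ := h κ (fun g => χ ((s g)⁻¹ * g)) (F ∪ c) (hF.union hc) (by
    intro g hg u hu hfix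
    have hu' : u ∈ fixSub G c := ⟨hu, fun x hx => hfix x (Or.inr hx)⟩
    show χ ((s (g * u))⁻¹ * (g * u)) = χ ((s g)⁻¹ * g)
    rw [hs' g u hu', ← mul_assoc]
    exact hχ _ (hs g) u hu' (fun x hx => hfix x (Or.inl hx))) E hE (fun e he => (hEG he).1)
  refine ⟨(s α)⁻¹ * α, hs α, fun e he e' he' => ?_⟩
  have := hα' e he e' he'
  simp only [hs' α e (hEG he), hs' α e' (hEG he')] at this
  rwa [mul_assoc, mul_assoc]

end Aux
end PaperDef

namespace PaperDef

section Aux2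

variable {L : Language} {M : Type} [L.Structure M]

theorem pinv (w : Equiv.Perm M) (x : M) : w⁻¹ (w x) = x := w.symm_apply_apply x

theorem ultra_one {G : Subgroup (Equiv.Perm M)} (h : RP G) :
    ∃ 𝒰 : Ultrafilter (Equiv.Perm M), (∀ᶠ g in (𝒰 : Filter (Equiv.Perm M)), g ∈ G) ∧
      ∀ (P : Equiv.Perm M → Prop) (F : Set M), F.Finite →
        (∀ g ∈ G, ∀ u ∈ G, (∀ x ∈ F, u x = x) → (P (g * u) ↔ P g)) → ∀ e ∈ G,
        ((∀ᶠ g in (𝒰 : Filter (Equiv.Perm M)), P (g * e)) ↔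
          ∀ᶠ g in (𝒰 : Filter (Equiv.Perm M)), P g) := by
  classical
  let S : Set (Set (Equiv.Perm M)) := {A | ∃ (P : Equiv.Perm M → Prop) (F : Set M)
    (e : Equiv.Perm M), F.Finite ∧
      (∀ g ∈ G, ∀ u ∈ G, (∀ x ∈ F, u x = x) → (P (g * u) ↔ P g)) ∧ e ∈ G ∧
      A = {g | g ∈ G ∧ (P (g * e) ↔ P g)}}
  obtain ⟨𝒰, h𝒰⟩ := Ultrafilter.exists_ultrafilter_of_finite_inter_nonempty S (by
    intro T hT
    have hT' : ∀ A : T, (A : Set (Equiv.Perm M)) ∈ S := fun A => hT A.2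
    choose P F e hF hP he hA using hT'
    obtain ⟨α, hα, hα'⟩ := h (T → Prop) (fun g A => P A g) (⋃ A, F A) (Set.finite_iUnion hF)
      (by
        intro g hg u hu hfix
        funext A
        exact propext (hP A g hg u hu (fun x hx => hfix x (Set.mem_iUnion.2 ⟨A, hx⟩))))
      (insert 1 (Set.range e)) ((Set.finite_range e).insert _)
      (by
        rintro x (rfl | ⟨A, rfl⟩)
        · exact one_mem G
        · exact he A)
    refine ⟨α, fun A hAT => ?_⟩
    have h1 := hA ⟨A, hAT⟩
    simp only at h1
    rw [h1]
    refine ⟨hα, ?_⟩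
    have h2 := congrFun (hα' (e ⟨A, hAT⟩) (Or.inr ⟨_, rfl⟩) 1 (Or.inl rfl)) ⟨A, hAT⟩
    rw [mul_one] at h2
    exact iff_of_eq h2)
  have key : ∀ (P : Equiv.Perm M → Prop) (F : Set M), F.Finite →
        (∀ g ∈ G, ∀ u ∈ G, (∀ x ∈ F, u x = x) → (P (g * u) ↔ P g)) → ∀ e ∈ G,
        (∀ᶠ g in (𝒰 : Filter (Equiv.Perm M)), g ∈ G ∧ (P (g * e) ↔ P g)) := by
    intro P F hF hP e he
    exact h𝒰 ⟨P, F, e, hF, hP, he, rfl⟩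
  refine ⟨𝒰, ?_, ?_⟩
  · exact (key (fun _ => True) ∅ Set.finite_empty (by simp) 1 (one_mem G)).mono fun g hg => hg.1
  · intro P F hF hP e he
    exact Filter.eventually_congr ((key P F hF hP e he).mono fun g hg => hg.2)

theorem ultra_n {G : Subgroup (Equiv.Perm M)} (h : RP G) (n : ℕ) :
    ∃ 𝒱 : Ultrafilter (Fin n → Equiv.Perm M),
      (∀ᶠ g in (𝒱 : Filter (Fin n → Equiv.Perm M)), ∀ i, g i ∈ G) ∧
      ∀ (P : (Fin n → Equiv.Perm M) → Prop) (F : Set M), F.Finite →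
        (∀ g u : Fin n → Equiv.Perm M, (∀ i, g i ∈ G) → (∀ i, u i ∈ G) →
          (∀ i, ∀ x ∈ F, u i x = x) → (P (g * u) ↔ P g)) →
        ∀ e : Fin n → Equiv.Perm M, (∀ i, e i ∈ G) →
        ((∀ᶠ g in (𝒱 : Filter (Fin n → Equiv.Perm M)), P (g * e)) ↔
          ∀ᶠ g in (𝒱 : Filter (Fin n → Equiv.Perm M)), P g) := by
  obtain ⟨𝒰, h𝒰G, h𝒰⟩ := ultra_one h
  induction n with
  | zero =>
    refine ⟨pure default, Filter.Eventually.of_forall fun g i => i.elim0, ?_⟩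
    intro P F _ _ e _
    have : ∀ g : Fin 0 → Equiv.Perm M, g * e = g := fun g => Subsingleton.elim _ _
    simp only [this]
  | succ n ih =>
    obtain ⟨𝒱, h𝒱G, h𝒱⟩ := ih
    let 𝒲 : Ultrafilter (Fin (n + 1) → Equiv.Perm M) :=
      𝒰.bind (fun g => 𝒱.map (fun g' => (Fin.cons g g' : Fin (n + 1) → Equiv.Perm M)))
    have h𝒲 : ∀ p : (Fin (n + 1) → Equiv.Perm M) → Prop,
        (∀ᶠ g in (𝒲 : Filter (Fin (n + 1) → Equiv.Perm M)), p g) ↔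
        ∀ᶠ g in (𝒰 : Filter (Equiv.Perm M)), ∀ᶠ g' in (𝒱 : Filter (Fin n → Equiv.Perm M)),
          p (Fin.cons g g') := fun p => Iff.rfl
    refine ⟨𝒲, ?_, ?_⟩
    · rw [h𝒲]
      filter_upwards [h𝒰G] with g hg
      filter_upwards [h𝒱G] with g' hg'
      exact Fin.cases hg hg'
    · intro P F hF hP e he
      rw [h𝒲, h𝒲]
      have hmul : ∀ (g e0 : Equiv.Perm M) (g' e' : Fin n → Equiv.Perm M),
          (Fin.cons g g' : Fin (n + 1) → Equiv.Perm M) * (Fin.cons e0 e' : _) =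
            (Fin.cons (g * e0) (g' * e') : Fin (n + 1) → Equiv.Perm M) := by
        intro g e0 g' e'
        funext i
        refine Fin.cases ?_ (fun j => ?_) i
        · simp
        · simp
      obtain ⟨e0, e', rfl⟩ : ∃ e0 e', e = (Fin.cons e0 e' : Fin (n + 1) → Equiv.Perm M) :=
        ⟨e 0, Fin.tail e, (Fin.cons_self_tail e).symm⟩
      have he0 : e0 ∈ G := by simpa using he 0
      have he' : ∀ i, e' i ∈ G := fun i => by simpa using he i.succ
      simp only [hmul]
      have hcons : ∀ (g : Equiv.Perm M) (g' : Fin n → Equiv.Perm M), g ∈ G → (∀ i, g' i ∈ G) →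
          ∀ i, (Fin.cons g g' : Fin (n + 1) → Equiv.Perm M) i ∈ G := by
        intro g g' hg hg'
        exact Fin.cases hg hg'
      have step1 : ∀ g ∈ G, ((∀ᶠ g' in (𝒱 : Filter (Fin n → Equiv.Perm M)),
          P (Fin.cons g (g' * e'))) ↔
          ∀ᶠ g' in (𝒱 : Filter (Fin n → Equiv.Perm M)), P (Fin.cons g g')) := by
        intro g hg
        refine h𝒱 (fun g' => P (Fin.cons g g')) F hF ?_ e' he'
        intro g' u hg' hu hfix
        have := hP (Fin.cons g g') (Fin.cons 1 u) (hcons _ _ hg hg') (hcons _ _ (one_mem G) hu)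
          (Fin.cases (fun x _ => rfl) hfix)
        rwa [hmul, mul_one] at this
      have step2 := h𝒰 (fun g => ∀ᶠ g' in (𝒱 : Filter (Fin n → Equiv.Perm M)),
        P (Fin.cons g g')) F hF (by
          intro g hg u hu hfix
          apply Filter.eventually_congr
          filter_upwards [h𝒱G] with g' hg'
          have := hP (Fin.cons g g') (Fin.cons u 1) (hcons _ _ hg hg')
            (hcons _ _ hu (fun _ => one_mem G)) (Fin.cases hfix (fun _ x _ => rfl))
          rwa [hmul, mul_one] at this) e0 he0
      rw [← step2]
      apply Filter.eventually_congr
      filter_upwards [h𝒰G] with g hg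
      exact step1 _ (mul_mem hg he0)

theorem glue {X : Type} [Countable X] [Nonempty X] (G : Subgroup (Equiv.Perm M))
    (k : Set X → X → M)
    (hk : ∀ A B : Set X, A.Finite → B.Finite → A ⊆ B → ∃ v ∈ G, ∀ x ∈ A, v (k B x) = k A x) :
    ∃ h : X → M, ∀ A : Set X, A.Finite → ∃ u ∈ G, ∀ x ∈ A, u (k A x) = h x := by
  obtain ⟨φ, hφ⟩ := exists_surjective_nat X
  let A : ℕ → Set X := fun i => φ '' {j | j < i}
  have hAfin : ∀ i, (A i).Finite := fun i => (Set.finite_lt_nat i).image φ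
  have hAmono : ∀ i, A i ⊆ A (i + 1) := fun i =>
    Set.image_mono fun j (hj : j < i) => (Nat.lt_succ_of_lt hj : j < i + 1)
  choose v hvG hv using fun i => hk (A i) (A (i + 1)) (hAfin i) (hAfin _) (hAmono i)
  let u : ℕ → Equiv.Perm M := fun i => Nat.rec 1 (fun i w => w * v i) i
  have hu0 : u 0 = 1 := rfl
  have hus : ∀ i, u (i + 1) = u i * v i := fun i => rfl
  have huG : ∀ i, u i ∈ G := by
    intro i
    induction i with
    | zero => exact one_mem G
    | succ i ih => rw [hus]; exact mul_mem ih (hvG i)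
  have hstep : ∀ i, ∀ x ∈ A i, u (i + 1) (k (A (i + 1)) x) = u i (k (A i) x) := by
    intro i x hx
    rw [hus, Equiv.Perm.mul_apply, hv i x hx]
  choose e he using hφ
  have hmem : ∀ x i, e x < i → x ∈ A i := fun x i hi => ⟨e x, hi, he x⟩
  have hconst : ∀ x i, e x + 1 ≤ i →
      u i (k (A i) x) = u (e x + 1) (k (A (e x + 1)) x) := by
    intro x i hi
    induction i, hi using Nat.le_induction with
    | base => rfl
    | succ i hi ih => rw [hstep i x (hmem x i hi), ih]
  refine ⟨fun x => u (e x + 1) (k (A (e x + 1)) x), fun B hB => ?_⟩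
  obtain ⟨N, hN⟩ := (hB.image e).bddAbove
  have hN' : ∀ x ∈ B, e x < N + 1 := fun x hx => Nat.lt_succ_of_le (hN ⟨x, hx, rfl⟩)
  obtain ⟨w, hwG, hw⟩ := hk B (A (N + 1)) hB (hAfin _) (fun x hx => hmem x _ (hN' x hx))
  refine ⟨u (N + 1) * w⁻¹, mul_mem (huG (N + 1)) (inv_mem hwG), fun x hx => ?_⟩
  rw [← hw x hx, Equiv.Perm.mul_apply, pinv]
  exact hconst x (N + 1) (hN' x hx)

/-- Space of atomic types of families indexed by `ι`. -/
abbrev AtT (L : Language) (ι : Type) :=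
  (ι → ι → Prop) × (∀ r : (Σ n, L.Relations n), (Fin r.1 → ι) → Prop)

/-- The atomic type of a family. -/
def atq (L : Language) {M : Type} [L.Structure M] {ι : Type} (a : ι → M) : AtT L ι :=
  (fun i j => a i = a j, fun r s => Structure.RelMap r.2 (fun i => a (s i)))

theorem sameAt_of_atq {ι : Type} {a b : ι → M} (h : atq L a = atq L b) : SameAt L a b := by
  refine ⟨fun i j => ?_, fun n r s => ?_⟩
  · exact iff_of_eq (congrFun (congrFun (congrArg Prod.fst h) i) j)
  · exact iff_of_eq (congrFun (congrFun (congrArg Prod.snd h) ⟨n, r⟩) s)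

/-- Canonical functions over the constants `c`. -/
def Canon (L : Language) {M : Type} [L.Structure M] (c : Set M) {n : ℕ}
    (h : (Fin n → M) → M) : Prop :=
  ∀ e : Fin n → Equiv.Perm M, (∀ i, e i ∈ fixSub (AutG L M) c) →
    SameAt L (fun x => h (fun i => e i (x i))) h

theorem canonize [Countable M] [Nonempty M] (hrel : ∀ i, IsEmpty (L.Functions i))
    (hfin : Finite (Σ i, L.Relations i))
    (hord : Ordered L M) (hhom : L.IsUltrahomogeneous M) (hram : RamseyClass (L.age M))
    {c : Set M} (hc : c.Finite) {n : ℕ} (f : (Fin n → M) → M) :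
    ∃ h : (Fin n → M) → M, Canon L c h ∧ ∀ A : Set (Fin n → M), A.Finite →
      ∃ g : Fin n → Equiv.Perm M, (∀ i, g i ∈ fixSub (AutG L M) c) ∧ ∃ u ∈ AutG L M,
        ∀ x ∈ A, u (f (fun i => g i (x i))) = h x := by
  classical
  obtain ⟨𝒱, h𝒱G, h𝒱⟩ := ultra_n (rp_fix (rp_aut hrel hord hhom hram) hc) n
  have h1 : ∀ A : Set (Fin n → M), A.Finite → ∃ k : (Fin n → M) → M,
      ∀ᶠ g in (𝒱 : Filter (Fin n → Equiv.Perm M)), ∃ u ∈ AutG L M,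
        ∀ x ∈ A, u (f (fun i => g i (x i))) = k x := by
    intro A hA
    have := hA.to_subtype
    let q : (Fin n → Equiv.Perm M) → AtT L A :=
      fun g => atq L (fun x : A => f (fun i => g i (x.1 i)))
    obtain ⟨t, ht⟩ := Ultrafilter.eq_pure_of_finite (𝒱.map q)
    have ht' : ∀ᶠ g in (𝒱 : Filter (Fin n → Equiv.Perm M)), q g = t := by
      have : {t} ∈ 𝒱.map q := by rw [ht]; exact rfl
      exact this
    obtain ⟨g₀, hg₀⟩ := ht'.exists
    refine ⟨fun x => f (fun i => g₀ i (x i)), ?_⟩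
    filter_upwards [ht'] with g hg
    obtain ⟨u, hu, hu'⟩ := homog hrel hhom (sameAt_of_atq (hg.trans hg₀.symm))
    exact ⟨u, hu, fun x hx => hu' ⟨x, hx⟩⟩
  choose! k hk using h1
  obtain ⟨h, hh⟩ := glue (AutG L M) k (by
    intro A B hA hB hAB
    obtain ⟨g, ⟨u, hu, hu'⟩, ⟨w, hw, hw'⟩⟩ := ((hk A hA).and (hk B hB)).exists
    refine ⟨u * w⁻¹, mul_mem hu (inv_mem hw), fun x hx => ?_⟩
    rw [← hw' x (hAB hx), Equiv.Perm.mul_apply, pinv, hu' x hx])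
  have hlim : ∀ A : Set (Fin n → M), A.Finite →
      ∀ᶠ g in (𝒱 : Filter (Fin n → Equiv.Perm M)), ∃ u ∈ AutG L M,
        ∀ x ∈ A, u (f (fun i => g i (x i))) = h x := by
    intro A hA
    obtain ⟨w, hw, hw'⟩ := hh A hA
    filter_upwards [hk A hA] with g ⟨u, hu, hu'⟩
    exact ⟨w * u, mul_mem hw hu, fun x hx => by rw [Equiv.Perm.mul_apply, hu' x hx, hw' x hx]⟩
  refine ⟨h, ?_, fun A hA => ?_⟩
  swap
  · obtain ⟨g, hg, hg'⟩ := (h𝒱G.and (hlim A hA)).exists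
    exact ⟨g, hg, hg'⟩
  intro e he
  -- general transfer principle
  have hsame : ∀ (m : ℕ) (s : Fin m → Fin n → M),
      ∀ᶠ g in (𝒱 : Filter (Fin n → Equiv.Perm M)),
        SameAt L (fun l => f (fun i => g i (s l i))) (fun l => h (s l)) := by
    intro m s
    filter_upwards [hlim (Set.range s) (Set.finite_range s)] with g ⟨u, hu, hu'⟩
    exact sameAt_of_aut hu (fun l => hu' (s l) ⟨l, rfl⟩)
  have main : ∀ (m : ℕ) (s : Fin m → Fin n → M) (Q : (Fin m → M) → Prop),
      (∀ a b : Fin m → M, SameAt L a b → (Q a ↔ Q b)) →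
      (Q (fun l => h (fun i => e i (s l i))) ↔ Q (fun l => h (s l))) := by
    intro m s Q hQ
    have e1 : (∀ᶠ g in (𝒱 : Filter (Fin n → Equiv.Perm M)),
        Q (fun l => f (fun i => g i (s l i)))) ↔ Q (fun l => h (s l)) := by
      rw [Filter.eventually_congr ((hsame m s).mono fun g hg => hQ _ _ hg), Filter.eventually_const]
    have e2 : (∀ᶠ g in (𝒱 : Filter (Fin n → Equiv.Perm M)),
        Q (fun l => f (fun i => (g * e) i (s l i)))) ↔ Q (fun l => h (fun i => e i (s l i))) := by
      refine Iff.trans (Filter.eventually_congr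
        ((hsame m (fun l i => e i (s l i))).mono fun g hg => hQ _ _ hg)) ?_
      rw [Filter.eventually_const]
    rw [← e1, ← e2]
    refine h𝒱 (fun g => Q (fun l => f (fun i => g i (s l i))))
      (Set.range fun p : Fin m × Fin n => s p.1 p.2) (Set.finite_range _) ?_ e he
    intro g u hg hu hfix
    have : (fun l => f (fun i => (g * u) i (s l i))) = fun l => f (fun i => g i (s l i)) := by
      funext l
      congr 1
      funext i
      rw [Pi.mul_apply, Equiv.Perm.mul_apply, hfix i _ ⟨(l, i), rfl⟩]
    rw [this]
  refine ⟨fun x y => ?_, fun m r s => ?_⟩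
  · exact main 2 ![x, y] (fun a => a 0 = a 1) (fun a b hab => hab.1 0 1)
  · exact main m s (fun a => Structure.RelMap r a) (fun a b hab => hab.2 m r id)

/-- Finitely many canonical behaviours. -/
theorem finite_behaviours (hrel : ∀ i, IsEmpty (L.Functions i))
    (hfin : Finite (Σ i, L.Relations i)) (hhom : L.IsUltrahomogeneous M)
    {c : Set M} (hc : c.Finite) (n : ℕ) :
    ∃ (β : Type) (_ : Finite β) (b : ((Fin n → M) → M) → β),
      ∀ h h', Canon L c h → Canon L c h' → b h = b h' → SameAt L h h' := by
  classical
  have hc' := hc.to_subtype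
  let q : ∀ m : ℕ, (Fin m → Fin n → M) → (Fin n → AtT L (Fin m ⊕ c)) := fun m s j =>
    atq L (Sum.elim (fun l => s l j) (Subtype.val : c → M))
  have hq : ∀ m s s', q m s = q m s' → ∃ e : Fin n → Equiv.Perm M,
      (∀ i, e i ∈ fixSub (AutG L M) c) ∧ ∀ l i, e i (s l i) = s' l i := by
    intro m s s' hss
    have : ∀ j, ∃ g ∈ fixSub (AutG L M) c, ∀ l, g (s l j) = s' l j := by
      intro j
      obtain ⟨g, hg, hg'⟩ := homog hrel hhom (sameAt_of_atq (congrFun hss j))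
      exact ⟨g, ⟨hg, fun x hx => hg' (Sum.inr ⟨x, hx⟩)⟩, fun l => hg' (Sum.inl l)⟩
    choose e he he' using this
    exact ⟨e, he, fun l i => he' i l⟩
  let B := Set (Fin n → AtT L (Fin 2 ⊕ c)) ×
    (∀ r : (Σ i, L.Relations i), Set (Fin n → AtT L (Fin r.1 ⊕ c)))
  have hT : ∀ m : ℕ, Finite (Fin n → AtT L (Fin m ⊕ c)) := fun m => inferInstance
  have hB1 : Finite (Set (Fin n → AtT L (Fin 2 ⊕ c))) := inferInstance
  have hB2 : Finite (∀ r : (Σ i, L.Relations i), Set (Fin n → AtT L (Fin r.1 ⊕ c))) :=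
    inferInstance
  have hB : Finite B := Finite.instProd
  let b : ((Fin n → M) → M) → B := fun h =>
    ({t | ∃ s, q 2 s = t ∧ h (s 0) = h (s 1)},
      fun r => {t | ∃ s, q r.1 s = t ∧ Structure.RelMap r.2 (fun i => h (s i))})
  have main : ∀ h h', Canon L c h' → b h = b h' →
      (∀ x y, h x = h y → h' x = h' y) ∧
      ∀ (m : ℕ) (r : L.Relations m) (s : Fin m → Fin n → M),
        Structure.RelMap r (fun i => h (s i)) → Structure.RelMap r (fun i => h' (s i)) := by
    intro h h' hh' hb
    refine ⟨fun x y hxy => ?_, fun m r s hs => ?_⟩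
    · have h1 : q 2 ![x, y] ∈ (b h).1 := ⟨![x, y], rfl, hxy⟩
      rw [hb] at h1
      obtain ⟨s, hs, hs'⟩ := h1
      obtain ⟨e, he, he'⟩ := hq 2 s ![x, y] hs
      have h2 := ((hh' e he).1 (s 0) (s 1)).2 hs'
      simp only [he'] at h2
      exact h2
    · have h1 : q m s ∈ (b h).2 ⟨m, r⟩ := ⟨s, rfl, hs⟩
      rw [hb] at h1
      obtain ⟨s', hs, hs'⟩ := h1
      obtain ⟨e, he, he'⟩ := hq m s' s hs
      have h2 := ((hh' e he).2 m r s').2 hs'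
      simp only [he'] at h2
      exact h2
  obtain ⟨N, ⟨eqv⟩⟩ := Finite.exists_equiv_fin B
  refine ⟨Fin N, inferInstance, fun h => eqv (b h), fun h h' hh hh' hb => ?_⟩
  have hb := eqv.injective hb
  have m1 := main h h' hh' hb
  have m2 := main h' h hh hb.symm
  exact ⟨fun x y => ⟨m1.1 x y, m2.1 x y⟩, fun m r s => ⟨m1.2 m r s, m2.2 m r s⟩⟩

end Aux2
end PaperDef

namespace PaperDef

section Aux3

variable {L : Language} {M : Type} [L.Structure M]

theorem orbit_reps (hrel : ∀ i, IsEmpty (L.Functions i))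
    (hfin : Finite (Σ i, L.Relations i)) (hhom : L.IsUltrahomogeneous M)
    {m : ℕ} (R : (Fin m → M) → Prop) :
    ∃ (n : ℕ) (t : Fin n → Fin m → M), (∀ j, R (t j)) ∧
      ∀ x, R x → ∃ j, ∃ α ∈ AutG L M, ∀ i, α (t j i) = x i := by
  let J := {τ : AtT L (Fin m) // ∃ x, R x ∧ atq L x = τ}
  have hJ : Finite J := Subtype.finite
  obtain ⟨n, ⟨eqv⟩⟩ := Finite.exists_equiv_fin J
  choose y hy hy' using fun τ : J => τ.2
  refine ⟨n, fun j => y (eqv.symm j), fun j => hy _, fun x hx => ?_⟩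
  refine ⟨eqv ⟨atq L x, x, hx, rfl⟩, ?_⟩
  apply homog hrel hhom
  apply sameAt_of_atq
  rw [hy', Equiv.symm_apply_apply]

/-- The closed clone generated by `C₀` and `h`. -/
def cloneGen (C₀ : ∀ k : ℕ, Set ((Fin k → M) → M)) {n : ℕ} (h : (Fin n → M) → M) :
    ∀ k : ℕ, Set ((Fin k → M) → M) :=
  fun k => {g | ∀ C : ∀ j : ℕ, Set ((Fin j → M) → M), IsClosedClone C → CloneLE C₀ C →
    h ∈ C n → g ∈ C k}

theorem cloneGen_closed (C₀ : ∀ k : ℕ, Set ((Fin k → M) → M)) {n : ℕ} (h : (Fin n → M) → M) :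
    IsClosedClone (cloneGen C₀ h) := by
  refine ⟨fun k i C hC _ _ => hC.1 k i, fun k l f gs hf hgs C hC h0 hh => ?_,
    fun k g hg C hC h0 hh => ?_⟩
  · exact hC.2.1 k l f gs (hf C hC h0 hh) (fun j => hgs j C hC h0 hh)
  · refine hC.2.2 k g (fun F hF => ?_)
    obtain ⟨h', hh', hx⟩ := hg F hF
    exact ⟨h', hh' C hC h0 hh, hx⟩

theorem comp_unary {C : ∀ k : ℕ, Set ((Fin k → M) → M)} (hC : IsClosedClone C)
    {u : M → M} (hu : (fun x : Fin 1 → M => u (x 0)) ∈ C 1) {k : ℕ} {f : (Fin k → M) → M}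
    (hf : f ∈ C k) : (fun x => u (f x)) ∈ C k :=
  hC.2.1 k 1 _ (fun _ => f) hu (fun _ => hf)

theorem mem_of_sameAt (hrel : ∀ i, IsEmpty (L.Functions i)) (hhom : L.IsUltrahomogeneous M)
    {C : ∀ k : ℕ, Set ((Fin k → M) → M)} (hC : IsClosedClone C)
    (hA : ∀ u ∈ AutG L M, (fun x : Fin 1 → M => u (x 0)) ∈ C 1) {n : ℕ}
    {h h' : (Fin n → M) → M} (hs : SameAt L h h') (hh : h ∈ C n) : h' ∈ C n := by
  refine hC.2.2 n h' (fun F hF => ?_)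
  have := hF.to_subtype
  have hs' : SameAt L (fun x : F => h x.1) (fun x : F => h' x.1) :=
    ⟨fun i j => hs.1 i j, fun n r s => hs.2 n r (fun i => (s i).1)⟩
  obtain ⟨u, hu, hu'⟩ := homog hrel hhom hs'
  exact ⟨fun x => u (h x), comp_unary hC (hA u hu) hh, fun x hx => hu' ⟨x, hx⟩⟩

end Aux3

/-- **Proposition 13 of the paper.**  Let `Θ` (an `L'`-structure on `M`) with finite relational
signature be a reduct of a countably infinite ordered homogeneous Ramsey structure `Δ`
(an `L`-structure on `M`) with finite relational signature.  Then there are only finitely many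
closed clones minimal above `Pol(Θ)`, and every closed clone properly containing `Pol(Θ)`
contains a minimal one. -/
theorem finitely_many_minimal_clones
    (L L' : Language) (M : Type) [L.Structure M] [L'.Structure M] [Countable M] [Infinite M]
    (hLrel : ∀ i, IsEmpty (L.Functions i)) (hLfin : Finite (Σ i, L.Relations i))
    (hTrel : ∀ i, IsEmpty (L'.Functions i)) (hTfin : Finite (Σ i, L'.Relations i))
    (hord : Ordered L M) (hhom : L.IsUltrahomogeneous M) (hram : RamseyClass (L.age M))
    (hred : IsReduct L L' M) :
    {C : ∀ k : ℕ, Set ((Fin k → M) → M) | IsClosedClone C ∧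
        MinimalCloneAbove (PolSet L' M) C}.Finite ∧
      ∀ C : ∀ k : ℕ, Set ((Fin k → M) → M), IsClosedClone C → CloneLT (PolSet L' M) C →
        ∃ N : ∀ k : ℕ, Set ((Fin k → M) → M),
          IsClosedClone N ∧ MinimalCloneAbove (PolSet L' M) N ∧ CloneLE N C := by
  classical
  have hne : Nonempty M := inferInstance
  -- relations of the reduct are invariant
  have hinv : ∀ (R : Σ i, L'.Relations i), ∀ u ∈ AutG L M, ∀ x : Fin R.1 → M,
      Structure.RelMap R.2 (fun i => u (x i)) ↔ Structure.RelMap R.2 x := by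
    rintro ⟨m, r⟩ u hu x
    obtain ⟨φ, hφ⟩ := hred m r
    simp only
    rw [hφ, hφ]
    exact formula_inv hLrel hu φ x
  have hAutPol : ∀ u ∈ AutG L M, (fun x : Fin 1 → M => u (x 0)) ∈ PolSet L' M 1 := by
    intro u hu m r rows hrows
    exact (hinv ⟨m, r⟩ u hu (rows 0)).2 (hrows 0)
  -- representatives
  choose n t ht ht' using fun R : (Σ i, L'.Relations i) =>
    orbit_reps hLrel hLfin hhom (fun x : Fin R.1 → M => Structure.RelMap R.2 x)
  let c : (Σ i, L'.Relations i) → Set M := fun R =>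
    Set.range fun p : Fin (n R) × Fin R.1 => t R p.1 p.2
  have hc : ∀ R, (c R).Finite := fun R => Set.finite_range _
  let Good : ∀ R : (Σ i, L'.Relations i), ((Fin (n R) → M) → M) → Prop := fun R h =>
    Canon L (c R) h ∧ ¬ Structure.RelMap R.2 (fun i => h (fun j => t R j i))
  let 𝒩 : Set (∀ k : ℕ, Set ((Fin k → M) → M)) :=
    {N | ∃ R, ∃ h, Good R h ∧ N = cloneGen (PolSet L' M) h}
  have hNclosed : ∀ N ∈ 𝒩, IsClosedClone N := by
    rintro N ⟨R, h, _, rfl⟩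
    exact cloneGen_closed _ h
  have hNlt : ∀ N ∈ 𝒩, CloneLT (PolSet L' M) N := by
    rintro N ⟨R, h, hG, rfl⟩
    refine ⟨fun k g hg C _ h0 _ => h0 k hg, fun heq => ?_⟩
    have h1 : h ∈ cloneGen (PolSet L' M) h (n R) := fun C _ _ hh => hh
    rw [← heq] at h1
    exact hG.2 (h1 R.1 R.2 (t R) (ht R))
  have hNfin : 𝒩.Finite := by
    have : 𝒩 = ⋃ R, {N | ∃ h, Good R h ∧ N = cloneGen (PolSet L' M) h} := by
      ext N; simp [𝒩]
    rw [this]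
    apply Set.finite_iUnion
    intro R
    obtain ⟨β, hβ, b, hb⟩ := finite_behaviours hLrel hLfin hhom (hc R) (n R)
    have hle : ∀ h h', Good R h → Good R h' → b h = b h' →
        cloneGen (PolSet L' M) h ≤ cloneGen (PolSet L' M) h' := by
      intro h h' hG hG' hbb k g hg C hC h0 hh
      refine hg C hC h0 (mem_of_sameAt hLrel hhom hC (fun u hu => h0 1 (hAutPol u hu)) ?_ hh)
      exact hb h' h hG'.1 hG.1 hbb.symm
    let w : β → (∀ k : ℕ, Set ((Fin k → M) → M)) := fun v =>
      if hv : ∃ h, Good R h ∧ b h = v then cloneGen (PolSet L' M) hv.choose else PolSet L' M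
    refine (Set.finite_range w).subset ?_
    rintro N ⟨h, hG, rfl⟩
    have hv : ∃ h', Good R h' ∧ b h' = b h := ⟨h, hG, rfl⟩
    refine ⟨b h, ?_⟩
    have e1 : w (b h) = cloneGen (PolSet L' M) hv.choose := dif_pos hv
    rw [e1]
    obtain ⟨h1, h2⟩ := hv.choose_spec
    exact le_antisymm (hle _ _ h1 hG h2) (hle _ _ hG h1 h2.symm)
  have hNex : ∀ C : ∀ k : ℕ, Set ((Fin k → M) → M), IsClosedClone C → CloneLT (PolSet L' M) C →
      ∃ N ∈ 𝒩, N ≤ C := by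
    rintro C hC ⟨h0, hneq⟩
    have h1 : ∃ k, ∃ f ∈ C k, f ∉ PolSet L' M k := by
      by_contra hcon
      push Not at hcon
      exact hneq (funext fun k => Set.Subset.antisymm (h0 k) (fun f hf => hcon k f hf))
    obtain ⟨k, f, hf, hfP⟩ := h1
    have h2 : ∃ R : (Σ i, L'.Relations i), ∃ rows : Fin k → Fin R.1 → M,
        (∀ j, Structure.RelMap R.2 (rows j)) ∧
        ¬ Structure.RelMap R.2 (fun i => f (fun j => rows j i)) := by
      by_contra hcon
      push Not at hcon
      exact hfP fun m r rows hrows => hcon ⟨m, r⟩ rows hrows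
    obtain ⟨R, rows, hrows, hviol⟩ := h2
    have hCA : ∀ u ∈ AutG L M, (fun x : Fin 1 → M => u (x 0)) ∈ C 1 :=
      fun u hu => h0 1 (hAutPol u hu)
    choose σ α hα hα' using fun j => ht' R (rows j) (hrows j)
    -- a violating operation of bounded arity
    let g : (Fin (n R) → M) → M := fun x => f (fun j => α j (x (σ j)))
    have hg : g ∈ C (n R) :=
      hC.2.1 (n R) k f (fun j x => α j (x (σ j))) hf
        (fun j => comp_unary hC (hCA _ (hα j)) (hC.1 (n R) (σ j)))
    have hgviol : ¬ Structure.RelMap R.2 (fun i => g (fun j => t R j i)) := by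
      have : (fun i => g (fun j => t R j i)) = fun i => f (fun j => rows j i) := by
        funext i
        simp only [g, hα']
      rw [this]
      exact hviol
    obtain ⟨h, hcan, hh⟩ := canonize hLrel hLfin hord hhom hram (hc R) g
    have hhC : h ∈ C (n R) := by
      refine hC.2.2 (n R) h (fun F hF => ?_)
      obtain ⟨e, he, u, hu, hx⟩ := hh F hF
      refine ⟨fun x => u (g (fun i => e i (x i))), ?_, hx⟩
      refine comp_unary hC (hCA u hu) ?_
      exact hC.2.1 (n R) (n R) g (fun j x => e j (x j)) hg
        (fun j => comp_unary hC (hCA _ (he j).1) (hC.1 (n R) j))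
    have hgood : Good R h := by
      refine ⟨hcan, fun hR => hgviol ?_⟩
      obtain ⟨e, he, u, hu, hx⟩ := hh (Set.range fun i j => t R j i) (Set.finite_range _)
      refine (hinv R u hu _).1 ?_
      have : (fun i => u (g (fun j => t R j i))) = fun i => h (fun j => t R j i) := by
        funext i
        rw [← hx _ ⟨i, rfl⟩]
        have e1 : (fun j => e j (t R j i)) = fun j => t R j i :=
          funext fun j => (he j).2 _ ⟨(j, i), rfl⟩
        simp only [e1]
      rw [this]
      exact hR
    exact ⟨_, ⟨R, h, hgood, rfl⟩, fun k g' hg' => hg' C hC h0 hhC⟩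
  refine ⟨hNfin.subset ?_, ?_⟩
  · rintro C ⟨hC, hlt, hmin⟩
    obtain ⟨N, hN, hNC⟩ := hNex C hC hlt
    have := hmin N (hNclosed N hN) (hNlt N hN) hNC
    rwa [← this]
  · intro C hC hlt
    have hf : {N | N ∈ 𝒩 ∧ N ≤ C}.Finite := hNfin.subset fun N hN => hN.1
    obtain ⟨N₀, hN₀, hN₀C⟩ := hNex C hC hlt
    obtain ⟨N, hNmin⟩ := hf.exists_minimal ⟨N₀, hN₀, hN₀C⟩
    refine ⟨N, hNclosed N hNmin.1.1, ⟨hNlt N hNmin.1.1, ?_⟩, hNmin.1.2⟩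
    intro E hE hEl hEN
    obtain ⟨N', hN', hN'E⟩ := hNex E hE hEl
    have hEN' : E ≤ N := hEN
    have h3 : N ≤ N' := hNmin.2 ⟨hN', hN'E.trans (hEN'.trans hNmin.1.2)⟩ (hN'E.trans hEN')
    exact le_antisymm hEN' (h3.trans hN'E)

end PaperDef
end
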